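/- Let 0 < α < d, let μ be a Borel probability measure on ℝ^d with ϖ(r) := sup_{x∈ℝ^d} μ(B(x,r)) satisfying ϖ(r) ≤ C_ε r^{α−ε} for every ε > 0 and 0 < r ≤ 1. Let 1 ≤ p ≤ q ≤ 2 and assume the restriction inequality (∫ |f̂|² dμ)^{1/2} ≤ A_p ‖f‖_{L^p(ℝ^d)} holds for all Schwartz f with some finite A_p. Let χ ∈ C_c^∞(ℝ^d), λ > 0, and define m_λ(ξ) = ∫_{ℝ^d} χ(ξ−η)|ξ−η|^{λ−α} dμ(η). If λ > d(1/q − 1/2) − (d−α)/2, then there is C with ‖ℱ^{−1}[m_λ f̂]‖_{L^q(ℝ^d)} ≤ C ‖f‖_{L^p(ℝ^d)} for all Schwartz f. If in addition ∫₀¹ (t^{−α} ϖ(t))^{1/2} dt/t < ∞, then the same conclusion holds for λ = d(1/q − 1/2) − (d−α)/2. -/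

import Mathlib

open MeasureTheory Filter
open scoped ENNReal FourierTransform

section RestrictionMultipliers

open scoped Convolution RealInnerProductSpace ContDiff
open ContinuousLinearMap (mul)

set_option linter.unusedSectionVars false

variable {V : Type*} [NormedAddCommGroup V] [InnerProductSpace ℝ V] [FiniteDimensional ℝ V]
  [MeasurableSpace V] [BorelSpace V]

/-- The inverse Fourier transform of a measure. -/
noncomputable def measureFourierInv (μ : Measure V) (x : V) : ℂ :=
  ∫ η, (Real.fourierChar ⟪x, η⟫ : ℂ) ∂μ

/-- The supremum over all translates of the integral of `‖ψ‖` against `μ`. -/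
noncomputable def supIntegral (μ : Measure V) (ψ : V → ℂ) : ℝ≥0∞ :=
  ⨆ ξ, ∫⁻ η, ‖ψ (ξ - η)‖ₑ ∂μ

lemma continuous_measureFourierInv (μ : Measure V) [IsProbabilityMeasure μ] :
    Continuous (measureFourierInv μ) := by
  unfold measureFourierInv
  refine continuous_of_dominated (bound := fun _ => 1) (fun x => ?_) (fun x => ?_)
    (integrable_const _) ?_
  · exact (Continuous.aestronglyMeasurable (by fun_prop))
  · exact .of_forall fun η => (Circle.norm_coe _).le
  · exact .of_forall fun η => by fun_prop

lemma norm_measureFourierInv_le (μ : Measure V) [IsProbabilityMeasure μ] (x : V) :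
    ‖measureFourierInv μ x‖ ≤ 1 := by
  unfold measureFourierInv
  refine (norm_integral_le_integral_norm _).trans ?_
  simp_rw [Circle.norm_coe]
  simp

lemma fourier_measureFourierInv_mul (μ : Measure V) [IsProbabilityMeasure μ] {κ : V → ℂ}
    (hκ : Integrable κ) (ξ : V) :
    𝓕 (fun x => measureFourierInv μ x * κ x) ξ = ∫ η, 𝓕 κ (ξ - η) ∂μ := by
  have h1 : 𝓕 (fun x => measureFourierInv μ x * κ x) ξ
      = ∫ x, ∫ η, (Real.fourierChar (-⟪x, ξ - η⟫) : ℂ) * κ x ∂μ := by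
    rw [Real.fourier_eq]
    congr 1
    ext x
    rw [measureFourierInv, Circle.smul_def, smul_eq_mul, ← integral_mul_const,
      ← integral_const_mul]
    congr 1
    ext η
    rw [← mul_assoc, ← Circle.coe_mul, ← AddChar.map_add_eq_mul]
    congr 3
    rw [inner_sub_right]; ring
  rw [h1, integral_integral_swap]
  · rfl
  · have : Integrable (fun z : V × V => κ z.1) (volume.prod μ) := hκ.comp_fst μ
    refine this.mono ?_ (.of_forall fun z => ?_)
    swap
    · simp only [Function.uncurry]
      rw [norm_mul, Circle.norm_coe, one_mul]
    exact (Continuous.aestronglyMeasurable (by fun_prop)).mul this.aestronglyMeasurable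

/-- The translate of the Fourier transform of a Schwartz function also satisfies the
restriction inequality. -/
lemma lintegral_translate_fourier_sq_le (μ : Measure V) [IsProbabilityMeasure μ] {p A : ℝ}
    (hrestr : ∀ f : SchwartzMap V ℂ,
      (∫ ξ, ‖𝓕 (⇑f) ξ‖ ^ 2 ∂μ) ^ ((1:ℝ)/2) ≤
        A * (eLpNorm (⇑f) (ENNReal.ofReal p) volume).toReal)
    (h : SchwartzMap V ℂ) (v : V) :
    ∫⁻ η, ‖𝓕 (⇑h) (v + η)‖ₑ ^ 2 ∂μ ≤
      (ENNReal.ofReal A * eLpNorm (⇑h) (ENNReal.ofReal p) volume) ^ 2 := by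
  let g : SchwartzMap V ℂ := 𝓕⁻ (SchwartzMap.compSubConstCLM ℝ (-v) (𝓕 h))
  have hF : ∀ η, 𝓕 (⇑g) η = 𝓕 (⇑h) (v + η) := fun η => by
    have h1 : 𝓕 g = SchwartzMap.compSubConstCLM ℝ (-v) (𝓕 h) := by simp [g]
    rw [← SchwartzMap.fourier_coe, h1, SchwartzMap.compSubConstCLM_apply, SchwartzMap.fourier_coe, sub_neg_eq_add, add_comm]
  have hg : ∀ x, g x = (Real.fourierChar (-⟪v, x⟫) : ℂ) * h x := fun x => by
    have h2 : h x = 𝓕⁻ (⇑(𝓕 h : SchwartzMap V ℂ)) x := by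
      rw [← SchwartzMap.fourierInv_coe]; simp
    rw [h2]
    simp only [g]
    rw [SchwartzMap.fourierInv_coe, Real.fourierInv_eq, Real.fourierInv_eq, ← integral_const_mul,
      ← integral_add_right_eq_self _ (-v)]
    congr 1
    ext w
    rw [SchwartzMap.compSubConstCLM_apply, Circle.smul_def, Circle.smul_def, smul_eq_mul,
      smul_eq_mul, ← mul_assoc, ← Circle.coe_mul, ← AddChar.map_add_eq_mul]
    congr 3
    · rw [inner_add_left, inner_neg_left]; ring
    · simp
  have hnorm : eLpNorm (⇑g) (ENNReal.ofReal p) volume = eLpNorm (⇑h) (ENNReal.ofReal p) volume := by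
    refine eLpNorm_congr_norm_ae (.of_forall fun x => ?_)
    rw [hg, norm_mul, Circle.norm_coe, one_mul]
  have hfin : eLpNorm (⇑h) (ENNReal.ofReal p) volume ≠ ⊤ :=
    (h.memLp (ENNReal.ofReal p) volume).eLpNorm_ne_top
  have hr := hrestr g
  rw [hnorm] at hr
  simp_rw [hF] at hr
  have hc : Continuous (fun η => 𝓕 (⇑h) (v + η)) := by
    have := (𝓕 h).continuous
    rw [SchwartzMap.fourier_coe] at this
    fun_prop
  have hI0 : 0 ≤ ∫ ξ, ‖𝓕 (⇑h) (v + ξ)‖ ^ 2 ∂μ := integral_nonneg fun _ => by positivity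
  obtain ⟨C, hC⟩ : ∃ C, ∀ η, ‖𝓕 (⇑h) η‖ ≤ C :=
    ⟨_, fun η => SchwartzMap.norm_le_seminorm ℝ (𝓕 h) η⟩
  have hfin_int : Integrable (fun ξ => ‖𝓕 (⇑h) (v + ξ)‖ ^ 2) μ := by
    refine Integrable.mono' (integrable_const (C ^ 2))
      (hc.norm.pow 2).aestronglyMeasurable (.of_forall fun x => ?_)
    rw [Real.norm_of_nonneg (by positivity)]
    gcongr
    exact hC _
  have e1 : ∫⁻ η, ‖𝓕 (⇑h) (v + η)‖ₑ ^ 2 ∂μ = ENNReal.ofReal (∫ ξ, ‖𝓕 (⇑h) (v + ξ)‖ ^ 2 ∂μ) := by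
    rw [ofReal_integral_eq_lintegral_ofReal hfin_int (.of_forall fun _ => by positivity)]
    congr 1
    ext x
    rw [ENNReal.ofReal_pow (norm_nonneg _), ofReal_norm]
  rw [e1]
  set I := ∫ ξ, ‖𝓕 (⇑h) (v + ξ)‖ ^ 2 ∂μ
  have e2 : ENNReal.ofReal I = ENNReal.ofReal (I ^ ((1:ℝ)/2)) ^ 2 := by
    rw [← ENNReal.ofReal_pow (by positivity), ← Real.rpow_natCast, ← Real.rpow_mul hI0]
    norm_num
  rw [e2]
  gcongr
  refine (ENNReal.ofReal_le_ofReal hr).trans ?_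
  rw [ENNReal.ofReal_mul' ENNReal.toReal_nonneg, ENNReal.ofReal_toReal hfin]

/-- Plancherel's theorem for Schwartz functions, as an identity of lower integrals. -/
lemma lintegral_fourier_sq_eq (f : SchwartzMap V ℂ) :
    ∫⁻ ξ, ‖𝓕 (⇑f) ξ‖ₑ ^ 2 = ∫⁻ x, ‖f x‖ₑ ^ 2 := by
  have key : ∀ g : SchwartzMap V ℂ, ∫⁻ x, ‖g x‖ₑ ^ 2 = ENNReal.ofReal (∫ x, ‖g x‖ ^ 2) := by
    intro g
    have := (g.memLp 2 (μ := volume)).integrable_norm_pow (p := 2) (by norm_num)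
    rw [ofReal_integral_eq_lintegral_ofReal this (.of_forall fun _ => by positivity)]
    congr 1
    ext x
    rw [ENNReal.ofReal_pow (norm_nonneg _), ofReal_norm]
  have h1 := key (𝓕 f)
  rw [SchwartzMap.integral_norm_sq_fourier, ← key f] at h1
  exact h1

/-- The `L^p → L²` bound for convolution with the product of the Fourier transform of `μ` and
a compactly supported function. -/
lemma lintegral_convolution_sq_le (μ : Measure V) [IsProbabilityMeasure μ] {p A : ℝ}
    (hrestr : ∀ f : SchwartzMap V ℂ,
      (∫ ξ, ‖𝓕 (⇑f) ξ‖ ^ 2 ∂μ) ^ ((1:ℝ)/2) ≤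
        A * (eLpNorm (⇑f) (ENNReal.ofReal p) volume).toReal)
    (κ h : SchwartzMap V ℂ) (hκ : HasCompactSupport κ) (hh : HasCompactSupport h) :
    ∫⁻ x, ‖((fun x => measureFourierInv μ x * κ x) ⋆[mul ℂ ℂ, volume] h) x‖ₑ ^ 2 ≤
      supIntegral μ (𝓕 ⇑κ) * (∫⁻ ξ, ‖𝓕 (⇑κ) ξ‖ₑ) *
        (ENNReal.ofReal A * eLpNorm (⇑h) (ENNReal.ofReal p) volume) ^ 2 := by
  set K : V → ℂ := fun x => measureFourierInv μ x * κ x with hK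
  have hKc : Continuous K := (continuous_measureFourierInv μ).mul κ.continuous
  have hKs : HasCompactSupport K := hκ.mul_left
  have hKi : Integrable K := hKc.integrable_of_hasCompactSupport hKs
  have hs : HasCompactSupport (K ⋆[mul ℂ ℂ, volume] h) := hKs.convolution _ hh
  have hd : ContDiff ℝ ∞ (K ⋆[mul ℂ ℂ, volume] h) := by
    have := HasCompactSupport.contDiff_convolution_right (𝕜 := ℝ) (n := (⊤ : ℕ∞)) (μ := volume)
      ((mul ℂ ℂ).bilinearRestrictScalars ℝ) hh hKi.locallyIntegrable (h.smooth _)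
    exact this
  have hP := lintegral_fourier_sq_eq (hs.toSchwartzMap hd)
  have hco : ⇑(hs.toSchwartzMap hd) = K ⋆[mul ℂ ℂ, volume] h := rfl
  rw [hco] at hP
  rw [← hP]
  have hcψ : Continuous (𝓕 ⇑κ) := (𝓕 κ).continuous
  have hch : Continuous (𝓕 ⇑h) := (𝓕 h).continuous
  have hmψ := hcψ.measurable
  have hmh := hch.measurable
  have h1 : ∀ ξ, ‖𝓕 (K ⋆[mul ℂ ℂ, volume] h) ξ‖ₑ ^ 2 ≤
      supIntegral μ (𝓕 ⇑κ) * ∫⁻ η, ‖𝓕 (⇑κ) (ξ - η)‖ₑ * ‖𝓕 (⇑h) ξ‖ₑ ^ 2 ∂μ := by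
    intro ξ
    rw [Real.fourier_mul_convolution_eq hKi h.integrable, hK,
      fourier_measureFourierInv_mul μ κ.integrable, enorm_mul, mul_pow,
      lintegral_mul_const _ (by have := hcψ.measurable; fun_prop), ← mul_assoc, sq (‖∫ η, _ ∂μ‖ₑ)]
    gcongr
    · exact (enorm_integral_le_lintegral_enorm _).trans
        (le_iSup (fun ξ => ∫⁻ η, ‖𝓕 (⇑κ) (ξ - η)‖ₑ ∂μ) ξ)
    · exact enorm_integral_le_lintegral_enorm _
  calc ∫⁻ ξ, ‖𝓕 (K ⋆[mul ℂ ℂ, volume] h) ξ‖ₑ ^ 2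
      ≤ ∫⁻ ξ, supIntegral μ (𝓕 ⇑κ) * ∫⁻ η, ‖𝓕 (⇑κ) (ξ - η)‖ₑ * ‖𝓕 (⇑h) ξ‖ₑ ^ 2 ∂μ :=
        lintegral_mono h1
    _ = supIntegral μ (𝓕 ⇑κ) * ∫⁻ ξ, ∫⁻ η, ‖𝓕 (⇑κ) (ξ - η)‖ₑ * ‖𝓕 (⇑h) ξ‖ₑ ^ 2 ∂μ := by
        rw [lintegral_const_mul]
        apply Measurable.lintegral_prod_right
        fun_prop
    _ = supIntegral μ (𝓕 ⇑κ) * ∫⁻ η, ∫⁻ ξ, ‖𝓕 (⇑κ) (ξ - η)‖ₑ * ‖𝓕 (⇑h) ξ‖ₑ ^ 2 ∂volume ∂μ := by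
        rw [lintegral_lintegral_swap]
        fun_prop
    _ = supIntegral μ (𝓕 ⇑κ) *
          ∫⁻ η, ∫⁻ v, ‖𝓕 (⇑κ) v‖ₑ * ‖𝓕 (⇑h) (v + η)‖ₑ ^ 2 ∂volume ∂μ := by
        congr 2
        ext η
        rw [← lintegral_add_right_eq_self _ η]
        simp
    _ = supIntegral μ (𝓕 ⇑κ) *
          ∫⁻ v, ∫⁻ η, ‖𝓕 (⇑κ) v‖ₑ * ‖𝓕 (⇑h) (v + η)‖ₑ ^ 2 ∂μ := by
        rw [lintegral_lintegral_swap]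
        fun_prop
    _ ≤ supIntegral μ (𝓕 ⇑κ) * ∫⁻ v, ‖𝓕 (⇑κ) v‖ₑ *
          (ENNReal.ofReal A * eLpNorm (⇑h) (ENNReal.ofReal p) volume) ^ 2 := by
        gcongr with v
        rw [lintegral_const_mul _ (by fun_prop)]
        gcongr
        exact lintegral_translate_fourier_sq_le μ hrestr h v
    _ = _ := by
        rw [lintegral_mul_const _ (by fun_prop), mul_assoc]

lemma eLpNorm_ofReal_eq {p : ℝ} (hp : 1 ≤ p) (f : V → ℂ) :
    eLpNorm f (ENNReal.ofReal p) volume = (∫⁻ x, ‖f x‖ₑ ^ p) ^ (1 / p) := by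
  rw [eLpNorm_eq_lintegral_rpow_enorm_toReal (by simp; linarith) (by simp),
    ENNReal.toReal_ofReal (by linarith)]

/-- A smooth cutoff of a Schwartz function around `z`. -/
noncomputable def SchwartzMap.cutoff (θ : ContDiffBump (0 : V)) (f : SchwartzMap V ℂ) (z : V) :
    SchwartzMap V ℂ :=
  HasCompactSupport.toSchwartzMap (f := fun y => ((θ (y - z) : ℝ) : ℂ) * f y)
    (HasCompactSupport.mul_right (by
      have h := θ.hasCompactSupport.comp_homeomorph (Homeomorph.subRight z)
      exact h.comp_left (g := fun r : ℝ => (r : ℂ)) (by simp)))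
    (by
      have h1 : ContDiff ℝ ∞ (fun y => θ (y - z)) := θ.contDiff.comp (contDiff_id.sub contDiff_const)
      exact (Complex.ofRealCLM.contDiff.comp h1).mul (f.smooth _))

lemma SchwartzMap.cutoff_apply (θ : ContDiffBump (0 : V)) (f : SchwartzMap V ℂ) (z y : V) :
    f.cutoff θ z y = ((θ (y - z) : ℝ) : ℂ) * f y := rfl

lemma SchwartzMap.hasCompactSupport_cutoff (θ : ContDiffBump (0 : V)) (f : SchwartzMap V ℂ)
    (z : V) : HasCompactSupport (f.cutoff θ z) :=
  HasCompactSupport.mul_right (by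
      have h := θ.hasCompactSupport.comp_homeomorph (Homeomorph.subRight z)
      exact h.comp_left (g := fun r : ℝ => (r : ℂ)) (by simp))

lemma convolution_cutoff_eq_zero {K : V → ℂ} {S : ℝ} (hKS : ∀ x, S < ‖x‖ → K x = 0)
    (θ : ContDiffBump (0 : V)) (hθ : θ.rOut = 2 * S) (f : SchwartzMap V ℂ) {x z : V}
    (hxz : 3 * S < dist x z) : (K ⋆[mul ℂ ℂ, volume] f.cutoff θ z) x = 0 := by
  rw [convolution_def]
  refine integral_eq_zero_of_ae (.of_forall fun t => ?_)
  simp only [ContinuousLinearMap.mul_apply', SchwartzMap.cutoff_apply, Pi.zero_apply]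
  by_cases ht : S < ‖t‖
  · simp [hKS t ht]
  · rw [θ.zero_of_le_dist (x := x - t - z)]
    · simp
    · rw [hθ, dist_zero_right]
      rw [dist_eq_norm] at hxz
      have : ‖x - z‖ ≤ ‖x - t - z‖ + ‖t‖ := by
        calc ‖x - z‖ = ‖(x - t - z) + t‖ := by congr 1; abel
          _ ≤ _ := norm_add_le _ _
      linarith

lemma integral_convolution_cutoff {K : V → ℂ} (hK : Continuous K) {S : ℝ}
    (hKS : ∀ x, S < ‖x‖ → K x = 0) (θ : ContDiffBump (0 : V)) (f : SchwartzMap V ℂ) (x : V) :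
    ∫ z, (K ⋆[mul ℂ ℂ, volume] f.cutoff θ z) x =
      ((∫ z, θ z : ℝ) : ℂ) * (K ⋆[mul ℂ ℂ, volume] f) x := by
  simp only [convolution_def, ContinuousLinearMap.mul_apply', SchwartzMap.cutoff_apply]
  rw [integral_integral_swap]
  · rw [← integral_const_mul]
    congr 1
    ext t
    have h1 : ∫ z, ((θ (x - t - z) : ℝ) : ℂ) = ((∫ z, θ z : ℝ) : ℂ) := by
      rw [integral_sub_left_eq_self (fun z => ((θ z : ℝ) : ℂ)) volume (x - t)]
      exact integral_ofReal
    rw [← h1, ← integral_mul_const]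
    congr 1
    ext z
    ring
  · have hc : Continuous (Function.uncurry fun z t : V => K t * (((θ (x - t - z) : ℝ) : ℂ) * f (x - t))) := by
      have h1 := θ.continuous
      have h2 := f.continuous
      unfold Function.uncurry
      fun_prop
    refine hc.integrable_of_hasCompactSupport (HasCompactSupport.intro
      ((isCompact_closedBall x (S + θ.rOut)).prod (isCompact_closedBall (0 : V) S)) ?_)
    rintro ⟨z, t⟩ hzt
    simp only [Function.uncurry]
    by_cases ht : S < ‖t‖
    · simp [hKS t ht]
    · rw [θ.zero_of_le_dist (x := x - t - z)]
      · simp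
      · by_contra! hlt
        apply hzt
        simp only [dist_zero_right] at hlt
        refine ⟨?_, by simpa using ht⟩
        simp only [Metric.mem_closedBall, dist_eq_norm]
        have : ‖z - x‖ ≤ ‖x - t - z‖ + ‖t‖ := by
          calc ‖z - x‖ = ‖(x - t - z) + t‖ := by rw [← norm_neg]; congr 1; abel
            _ ≤ _ := norm_add_le _ _
        linarith

lemma continuous_convolution_cutoff {K : V → ℂ} (hK : Continuous K) {S : ℝ}
    (hKS : ∀ x, S < ‖x‖ → K x = 0) (θ : ContDiffBump (0 : V)) (f : SchwartzMap V ℂ) :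
    Continuous (fun w : V × V => (K ⋆[mul ℂ ℂ, volume] f.cutoff θ w.2) w.1) := by
  have hKs : HasCompactSupport K := HasCompactSupport.intro (isCompact_closedBall (0 : V) S)
    (fun x hx => hKS x (by simpa using hx))
  have hKi : Integrable K := hK.integrable_of_hasCompactSupport hKs
  obtain ⟨C, hC⟩ : ∃ C, ∀ y, ‖f y‖ ≤ C := ⟨_, fun y => SchwartzMap.norm_le_seminorm ℝ f y⟩
  simp only [convolution_def, ContinuousLinearMap.mul_apply', SchwartzMap.cutoff_apply]
  have h1 := θ.continuous
  have h2 := f.continuous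
  refine continuous_of_dominated (bound := fun t => ‖K t‖ * (1 * C)) (fun w => ?_) (fun w => ?_)
    (hKi.norm.mul_const _) ?_
  · exact Continuous.aestronglyMeasurable (by fun_prop)
  · refine .of_forall fun t => ?_
    rw [norm_mul, norm_mul]
    gcongr
    · rw [Complex.norm_real, Real.norm_of_nonneg θ.nonneg]; exact θ.le_one
    · exact hC _
  · exact .of_forall fun t => by fun_prop

lemma lintegral_eLpNorm_cutoff_rpow_le {p q : ℝ} (hp : 1 ≤ p) (hpq : p ≤ q)
    (θ : ContDiffBump (0 : V)) (f : SchwartzMap V ℂ) :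
    ∫⁻ z, eLpNorm (f.cutoff θ z) (ENNReal.ofReal p) volume ^ q ≤
      volume (Metric.closedBall (0 : V) θ.rOut) *
        eLpNorm f (ENNReal.ofReal p) volume ^ q := by
  have hp0 : 0 < p := by linarith
  set N := eLpNorm f (ENNReal.ofReal p) volume with hN
  have hle : ∀ z y, ‖f.cutoff θ z y‖ ≤ ‖f y‖ := fun z y => by
    rw [SchwartzMap.cutoff_apply, norm_mul, Complex.norm_real, Real.norm_of_nonneg θ.nonneg]
    exact mul_le_of_le_one_left (norm_nonneg _) θ.le_one
  have h1 : ∀ z, eLpNorm (f.cutoff θ z) (ENNReal.ofReal p) volume ≤ N := fun z =>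
    eLpNorm_mono (hle z)
  have h2 : ∀ z, eLpNorm (f.cutoff θ z) (ENNReal.ofReal p) volume ^ q ≤
      N ^ (q - p) * ∫⁻ y, (Metric.closedBall y θ.rOut).indicator 1 z * ‖f y‖ₑ ^ p := by
    intro z
    calc eLpNorm (f.cutoff θ z) (ENNReal.ofReal p) volume ^ q
        = eLpNorm (f.cutoff θ z) (ENNReal.ofReal p) volume ^ (q - p) *
          eLpNorm (f.cutoff θ z) (ENNReal.ofReal p) volume ^ p := by
          rw [← ENNReal.rpow_add_of_nonneg _ _ (by linarith) hp0.le]; ring_nf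
      _ ≤ _ := by
          gcongr
          · exact h1 z
          · rw [eLpNorm_ofReal_eq hp, ← ENNReal.rpow_mul, one_div_mul_cancel hp0.ne',
              ENNReal.rpow_one]
            refine lintegral_mono fun y => ?_
            by_cases hz : z ∈ Metric.closedBall y θ.rOut
            · rw [Set.indicator_of_mem hz]
              simp only [Pi.one_apply, one_mul]
              gcongr
              exact enorm_le_iff_norm_le.2 (hle z y)
            · have : f.cutoff θ z y = 0 := by
                rw [SchwartzMap.cutoff_apply, θ.zero_of_le_dist]
                · simp
                · simp only [Metric.mem_closedBall, not_le, dist_eq_norm] at hz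
                  rw [dist_zero_right, ← norm_neg, neg_sub]; exact hz.le
              simp [this, hp0]
  have hm : Measurable (Function.uncurry fun z y : V =>
      (Metric.closedBall y θ.rOut).indicator (1 : V → ℝ≥0∞) z * ‖f y‖ₑ ^ p) := by
    have hs : MeasurableSet {w : V × V | dist w.1 w.2 ≤ θ.rOut} :=
      measurableSet_le (by fun_prop) (by fun_prop)
    have h3 : Measurable ({w : V × V | dist w.1 w.2 ≤ θ.rOut}.indicator (1 : V × V → ℝ≥0∞)) :=
      measurable_one.indicator hs
    have h4 : Measurable (fun w : V × V => ‖f w.2‖ₑ ^ p) := by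
      have := f.continuous.measurable
      fun_prop
    exact h3.mul h4
  calc ∫⁻ z, eLpNorm (f.cutoff θ z) (ENNReal.ofReal p) volume ^ q
      ≤ ∫⁻ z, N ^ (q - p) * ∫⁻ y, (Metric.closedBall y θ.rOut).indicator 1 z * ‖f y‖ₑ ^ p :=
        lintegral_mono h2
    _ = N ^ (q - p) * ∫⁻ y, ∫⁻ z, (Metric.closedBall y θ.rOut).indicator 1 z * ‖f y‖ₑ ^ p := by
        rw [lintegral_const_mul, lintegral_lintegral_swap hm.aemeasurable]
        exact hm.lintegral_prod_right
    _ = N ^ (q - p) * (volume (Metric.closedBall (0 : V) θ.rOut) * ∫⁻ y, ‖f y‖ₑ ^ p) := by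
        congr 1
        rw [← lintegral_const_mul _ (by have := f.continuous.measurable; fun_prop)]
        congr 1
        ext y
        rw [lintegral_mul_const _ (measurable_one.indicator Metric.isClosed_closedBall.measurableSet),
          lintegral_indicator_one Metric.isClosed_closedBall.measurableSet,
          Measure.addHaar_closedBall_center]
    _ = N ^ (q - p) * (volume (Metric.closedBall (0 : V) θ.rOut) * N ^ p) := by
        rw [hN, eLpNorm_ofReal_eq hp, ← ENNReal.rpow_mul _ (1 / p) p, one_div_mul_cancel hp0.ne',
              ENNReal.rpow_one]
    _ = volume (Metric.closedBall (0 : V) θ.rOut) * N ^ q := by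
        rw [mul_left_comm, ← ENNReal.rpow_add_of_nonneg _ _ (by linarith) hp0.le]; ring_nf

/-- Hölder's inequality on a set of finite measure. -/
lemma setLIntegral_enorm_rpow_le {Φ : V → ℂ} (hΦ : Continuous Φ) (E : Set V) {r s : ℝ}
    (hr : 0 < r) (hrs : r ≤ s) :
    ∫⁻ x in E, ‖Φ x‖ₑ ^ r ≤ (∫⁻ x in E, ‖Φ x‖ₑ ^ s) ^ (r / s) * volume E ^ (1 - r / s) := by
  have h := eLpNorm'_le_eLpNorm'_mul_rpow_measure_univ (μ := volume.restrict E) (f := Φ) hr hrs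
    hΦ.aestronglyMeasurable
  rw [eLpNorm', eLpNorm', Measure.restrict_apply_univ] at h
  have h' := ENNReal.rpow_le_rpow h hr.le
  rw [ENNReal.mul_rpow_of_nonneg _ _ hr.le, ← ENNReal.rpow_mul, ← ENNReal.rpow_mul,
    ← ENNReal.rpow_mul, one_div_mul_cancel hr.ne', ENNReal.rpow_one] at h'
  convert h' using 3
  · ring
  · field_simp

lemma measure_closedBall_le_ofReal_integral (θ : ContDiffBump (0 : V)) {S : ℝ} (hS : 0 ≤ S)
    (hθ : θ.rIn = S) :
    volume (Metric.closedBall (0 : V) (3 * S)) ≤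
      3 ^ Module.finrank ℝ V * ENNReal.ofReal (∫ z, θ z) := by
  have h1 : volume (Metric.closedBall (0 : V) (3 * S)) =
      3 ^ Module.finrank ℝ V * volume (Metric.closedBall (0 : V) S) := by
    rw [Measure.addHaar_closedBall_mul _ _ (by norm_num) hS]
    congr 1
    rw [ENNReal.ofReal_pow (by norm_num)]
    norm_num
  rw [h1]
  gcongr
  have h2 := θ.measure_closedBall_le_integral (volume : Measure V)
  rw [hθ] at h2
  rw [← ENNReal.ofReal_toReal (measure_closedBall_lt_top (x := (0:V)) (r := S)).ne]
  exact ENNReal.ofReal_le_ofReal h2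

lemma lintegral_lintegral_enorm_rpow_le {q : ℝ} (hq1 : 1 ≤ q) (hq : q ≤ 2) {T : ℝ} (hT : 0 < T)
    {Φ : V × V → ℂ} (hΦc : Continuous Φ) (hΦ0 : ∀ x z, T < dist x z → Φ (x, z) = 0) :
    ∫⁻ x, (∫⁻ z, ‖Φ (x, z)‖ₑ) ^ q ≤
      volume (Metric.closedBall (0 : V) T) ^ (q / 2) *
        ∫⁻ z, (∫⁻ x, ‖Φ (x, z)‖ₑ ^ (2 : ℝ)) ^ (q / 2) := by
  have hq0 : 0 < q := by linarith
  have hWx : ∀ x : V, volume (Metric.closedBall x T) = volume (Metric.closedBall (0 : V) T) :=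
    fun x => Measure.addHaar_closedBall_center _ _ _
  have hW0 : volume (Metric.closedBall (0 : V) T) ≠ 0 :=
    (Metric.measure_closedBall_pos _ _ hT).ne'
  have hWt : volume (Metric.closedBall (0 : V) T) ≠ ⊤ := measure_closedBall_lt_top.ne
  generalize volume (Metric.closedBall (0 : V) T) = W at *
  have hpt : ∀ x, (∫⁻ z, ‖Φ (x, z)‖ₑ) ^ q ≤ (∫⁻ z, ‖Φ (x, z)‖ₑ ^ q) * W ^ (q - 1) := by
    intro x
    have h2 : ∫⁻ z, ‖Φ (x, z)‖ₑ = ∫⁻ z in Metric.closedBall x T, ‖Φ (x, z)‖ₑ := by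
      rw [setLIntegral_eq_of_support_subset]
      intro z hz
      by_contra hzn
      apply hz
      simp only [Metric.mem_closedBall, not_le] at hzn
      rw [dist_comm] at hzn
      simp [hΦ0 x z hzn]
    have h3 := setLIntegral_enorm_rpow_le (Φ := fun z => Φ (x, z)) (by fun_prop)
      (Metric.closedBall x T) one_pos hq1
    simp only [ENNReal.rpow_one] at h3
    rw [hWx] at h3
    refine (ENNReal.rpow_le_rpow (h2.le.trans h3) hq0.le).trans ?_
    rw [ENNReal.mul_rpow_of_nonneg _ _ hq0.le, ← ENNReal.rpow_mul, ← ENNReal.rpow_mul,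
      one_div_mul_cancel hq0.ne', ENNReal.rpow_one]
    have : (1 - 1 / q) * q = q - 1 := by field_simp
    rw [this]
    gcongr
    exact Measure.restrict_le_self
  have hz : ∀ z, ∫⁻ x, ‖Φ (x, z)‖ₑ ^ q ≤
      (∫⁻ x, ‖Φ (x, z)‖ₑ ^ (2 : ℝ)) ^ (q / 2) * W ^ (1 - q / 2) := by
    intro z
    have h2 : ∫⁻ x, ‖Φ (x, z)‖ₑ ^ q = ∫⁻ x in Metric.closedBall z T, ‖Φ (x, z)‖ₑ ^ q := by
      rw [setLIntegral_eq_of_support_subset]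
      intro x hx
      by_contra hxn
      apply hx
      simp only [Metric.mem_closedBall, not_le] at hxn
      simp [hΦ0 x z hxn, hq0]
    have h3 := setLIntegral_enorm_rpow_le (Φ := fun x => Φ (x, z)) (by fun_prop)
      (Metric.closedBall z T) hq0 hq
    rw [hWx] at h3
    refine h2.le.trans (h3.trans ?_)
    gcongr
    exact Measure.restrict_le_self
  have hmeas : Measurable (fun w : V × V => ‖Φ w‖ₑ ^ q) := by
    have := hΦc.measurable
    fun_prop
  calc ∫⁻ x, (∫⁻ z, ‖Φ (x, z)‖ₑ) ^ q
      ≤ ∫⁻ x, (∫⁻ z, ‖Φ (x, z)‖ₑ ^ q) * W ^ (q - 1) := lintegral_mono hpt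
    _ = (∫⁻ z, ∫⁻ x, ‖Φ (x, z)‖ₑ ^ q) * W ^ (q - 1) := by
        rw [lintegral_mul_const' _ _ (ENNReal.rpow_ne_top_of_nonneg (by linarith) hWt),
          lintegral_lintegral_swap hmeas.aemeasurable]
    _ ≤ (∫⁻ z, (∫⁻ x, ‖Φ (x, z)‖ₑ ^ (2 : ℝ)) ^ (q / 2) * W ^ (1 - q / 2)) * W ^ (q - 1) := by
        gcongr
        exact hz _
    _ = (∫⁻ z, (∫⁻ x, ‖Φ (x, z)‖ₑ ^ (2 : ℝ)) ^ (q / 2)) * (W ^ (1 - q / 2) * W ^ (q - 1)) := by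
        rw [lintegral_mul_const' _ _ (ENNReal.rpow_ne_top_of_nonneg (by linarith) hWt), mul_assoc]
    _ = _ := by
        rw [← ENNReal.rpow_add _ _ hW0 hWt, mul_comm]
        congr 2
        ring

/-- A convolution operator with a compactly supported kernel, bounded from `L^p` to `L²`, is
bounded from `L^p` to `L^q` for `p ≤ q ≤ 2`. -/
lemma eLpNorm_convolution_le_of_support {p q : ℝ} (hp : 1 ≤ p) (hpq : p ≤ q) (hq : q ≤ 2)
    {K : V → ℂ} (hK : Continuous K) {S : ℝ} (hS : 0 < S) (hKS : ∀ x, S < ‖x‖ → K x = 0)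
    {B : ℝ≥0∞} (hBt : B ≠ ⊤)
    (hB : ∀ h : SchwartzMap V ℂ, HasCompactSupport h →
      ∫⁻ x, ‖(K ⋆[mul ℂ ℂ, volume] h) x‖ₑ ^ 2 ≤
        B * eLpNorm h (ENNReal.ofReal p) volume ^ 2)
    (f : SchwartzMap V ℂ) :
    eLpNorm (K ⋆[mul ℂ ℂ, volume] f) (ENNReal.ofReal q) volume ≤
      3 ^ Module.finrank ℝ V * volume (Metric.closedBall (0 : V) (3 * S)) ^ (1 / q - 1 / 2) *
        B ^ ((1 : ℝ) / 2) * eLpNorm f (ENNReal.ofReal p) volume := by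
  have hq1 : 1 ≤ q := hp.trans hpq
  have hq0 : 0 < q := by linarith
  obtain ⟨θ, hθi, hθo⟩ : ∃ θ : ContDiffBump (0 : V), θ.rIn = S ∧ θ.rOut = 2 * S :=
    ⟨⟨S, 2 * S, hS, by linarith⟩, rfl, rfl⟩
  have hW0 : volume (Metric.closedBall (0 : V) (3 * S)) ≠ 0 :=
    (Metric.measure_closedBall_pos _ _ (by linarith)).ne'
  have hWt : volume (Metric.closedBall (0 : V) (3 * S)) ≠ ⊤ := measure_closedBall_lt_top.ne
  have hWI := measure_closedBall_le_ofReal_integral θ hS.le hθi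
  have hfin : ∀ x, ENNReal.ofReal (∫ z, θ z) * ‖(K ⋆[mul ℂ ℂ, volume] f) x‖ₑ ≤
      ∫⁻ z, ‖(K ⋆[mul ℂ ℂ, volume] f.cutoff θ z) x‖ₑ := by
    intro x
    have := enorm_integral_le_lintegral_enorm (μ := volume)
      (fun z => (K ⋆[mul ℂ ℂ, volume] f.cutoff θ z) x)
    rw [integral_convolution_cutoff hK hKS θ f x, enorm_mul] at this
    refine le_trans (le_of_eq ?_) this
    congr 1
    have h0 : 0 ≤ ∫ z, θ z := integral_nonneg fun z => θ.nonneg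
    rw [← Real.enorm_of_nonneg h0, ← ofReal_norm, ← ofReal_norm, Complex.norm_real]
  have hkey := lintegral_lintegral_enorm_rpow_le hq1 hq (T := 3 * S) (by linarith)
    (continuous_convolution_cutoff hK hKS θ f)
    (fun x z hxz => convolution_cutoff_eq_zero hKS θ hθo f hxz)
  have hcut : ∫⁻ z, eLpNorm (f.cutoff θ z) (ENNReal.ofReal p) volume ^ q ≤
      volume (Metric.closedBall (0 : V) (3 * S)) *
        eLpNorm f (ENNReal.ofReal p) volume ^ q := by
    refine (lintegral_eLpNorm_cutoff_rpow_le hp hpq θ f).trans ?_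
    gcongr
    rw [hθo]; linarith
  have hB2 : ∀ z, (∫⁻ x, ‖(K ⋆[mul ℂ ℂ, volume] f.cutoff θ z) x‖ₑ ^ (2 : ℝ)) ^ (q / 2) ≤
      B ^ (q / 2) * eLpNorm (f.cutoff θ z) (ENNReal.ofReal p) volume ^ q := by
    intro z
    have h4 := hB _ (f.hasCompactSupport_cutoff θ z)
    simp only [← ENNReal.rpow_two] at h4
    refine (ENNReal.rpow_le_rpow h4 (by positivity)).trans (le_of_eq ?_)
    rw [ENNReal.mul_rpow_of_nonneg _ _ (by positivity), ← ENNReal.rpow_mul]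
    congr 2
    ring
  generalize volume (Metric.closedBall (0 : V) (3 * S)) = W at *
  generalize ENNReal.ofReal (∫ z, θ z) = I at *
  generalize eLpNorm f (ENNReal.ofReal p) volume = N at *
  have hKf : (I * eLpNorm (K ⋆[mul ℂ ℂ, volume] f) (ENNReal.ofReal q) volume) ^ q ≤
      (W ^ (1 / q + 1 / 2) * B ^ ((1 : ℝ) / 2) * N) ^ q := by
    calc _ ≤ ∫⁻ x, (I * ‖(K ⋆[mul ℂ ℂ, volume] f) x‖ₑ) ^ q := by
          rw [ENNReal.mul_rpow_of_nonneg _ _ hq0.le, eLpNorm_ofReal_eq hq1, ← ENNReal.rpow_mul,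
            one_div_mul_cancel hq0.ne', ENNReal.rpow_one]
          simp_rw [ENNReal.mul_rpow_of_nonneg _ _ hq0.le]
          exact lintegral_const_mul_le _ _
      _ ≤ ∫⁻ x, (∫⁻ z, ‖(K ⋆[mul ℂ ℂ, volume] f.cutoff θ z) x‖ₑ) ^ q :=
          lintegral_mono fun x => ENNReal.rpow_le_rpow (hfin x) hq0.le
      _ ≤ W ^ (q / 2) * ∫⁻ z, (∫⁻ x, ‖(K ⋆[mul ℂ ℂ, volume] f.cutoff θ z) x‖ₑ ^ (2 : ℝ)) ^ (q / 2) :=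
          hkey
      _ ≤ W ^ (q / 2) * (B ^ (q / 2) * (W * N ^ q)) := by
          gcongr
          refine (lintegral_mono hB2).trans ?_
          rw [lintegral_const_mul' _ _ (ENNReal.rpow_ne_top_of_nonneg (by positivity) hBt)]
          gcongr
      _ = (W ^ (1 / q + 1 / 2) * B ^ ((1 : ℝ) / 2) * N) ^ q := by
          rw [ENNReal.mul_rpow_of_nonneg _ _ hq0.le, ENNReal.mul_rpow_of_nonneg _ _ hq0.le,
            ← ENNReal.rpow_mul, ← ENNReal.rpow_mul]
          have e1 : (1 / q + 1 / 2) * q = 1 + q / 2 := by field_simp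
          rw [e1, ENNReal.rpow_add _ _ hW0 hWt, ENNReal.rpow_one]
          have e2 : 1 / 2 * q = q / 2 := by ring
          rw [e2]
          ring
  rw [ENNReal.rpow_le_rpow_iff hq0] at hKf
  generalize eLpNorm (K ⋆[mul ℂ ℂ, volume] f) (ENNReal.ofReal q) volume = Q at *
  rw [← ENNReal.mul_le_mul_iff_right hW0 hWt]
  calc W * Q ≤ 3 ^ Module.finrank ℝ V * I * Q := by gcongr
    _ ≤ 3 ^ Module.finrank ℝ V * (W ^ (1 / q + 1 / 2) * B ^ ((1 : ℝ) / 2) * N) := by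
        rw [mul_assoc]; gcongr
    _ = _ := by
        have e1 : 1 / q + 1 / 2 = 1 + (1 / q - 1 / 2) := by ring
        rw [e1, ENNReal.rpow_add _ _ hW0 hWt, ENNReal.rpow_one]
        ring

/-- The `L^p → L²(μ)` restriction inequality with constant `A`. -/
def HasRestriction (μ : Measure V) (p A : ℝ) : Prop :=
  ∀ f : SchwartzMap V ℂ, (∫ ξ, ‖𝓕 (⇑f) ξ‖ ^ 2 ∂μ) ^ ((1:ℝ)/2) ≤
    A * (eLpNorm (⇑f) (ENNReal.ofReal p) volume).toReal

/-- The product of the dilate by `S` of a compactly supported `ρ` with `𝓕⁻ E`. -/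
noncomputable def SchwartzMap.truncate {ρ : SchwartzMap V ℂ} (hρ : HasCompactSupport ρ) {S : ℝ}
    (hS : 0 < S) (E : SchwartzMap V ℂ) : SchwartzMap V ℂ :=
  HasCompactSupport.toSchwartzMap (f := fun x => ρ (S⁻¹ • x) * (𝓕⁻ E : SchwartzMap V ℂ) x)
    (HasCompactSupport.mul_right
      (hρ.comp_homeomorph (Homeomorph.smulOfNeZero S⁻¹ (inv_ne_zero hS.ne'))))
    (((ρ.smooth _).comp (contDiff_const_smul _)).mul (SchwartzMap.smooth _ _))

lemma SchwartzMap.truncate_apply {ρ : SchwartzMap V ℂ} (hρ : HasCompactSupport ρ) {S : ℝ}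
    (hS : 0 < S) (E : SchwartzMap V ℂ) (x : V) :
    SchwartzMap.truncate hρ hS E x = ρ (S⁻¹ • x) * (𝓕⁻ E : SchwartzMap V ℂ) x := rfl

lemma SchwartzMap.hasCompactSupport_truncate {ρ : SchwartzMap V ℂ} (hρ : HasCompactSupport ρ)
    {S : ℝ} (hS : 0 < S) (E : SchwartzMap V ℂ) :
    HasCompactSupport (SchwartzMap.truncate hρ hS E) :=
  HasCompactSupport.mul_right
      (hρ.comp_homeomorph (Homeomorph.smulOfNeZero S⁻¹ (inv_ne_zero hS.ne')))

lemma SchwartzMap.fourier_truncate {ρ : SchwartzMap V ℂ} (hρ : HasCompactSupport ρ) {S : ℝ}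
    (hS : 0 < S) (E : SchwartzMap V ℂ) (ξ : V) :
    𝓕 (⇑(SchwartzMap.truncate hρ hS E)) ξ =
      ∫ v, (𝓕 ρ : SchwartzMap V ℂ) v * E (ξ - S⁻¹ • v) := by
  have hρ' : ∀ x, ρ x = ∫ v, (Real.fourierChar ⟪v, x⟫ : ℂ) * (𝓕 ρ : SchwartzMap V ℂ) v := by
    intro x
    have h : ρ = 𝓕⁻ (𝓕 ρ) := by simp
    conv_lhs => rw [h, SchwartzMap.fourierInv_coe, Real.fourierInv_eq]
    rfl
  have h1 : 𝓕 (⇑(SchwartzMap.truncate hρ hS E)) ξ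
      = ∫ x, ∫ v, (𝓕 ρ : SchwartzMap V ℂ) v *
        ((Real.fourierChar (-⟪x, ξ - S⁻¹ • v⟫) : ℂ) * (𝓕⁻ E : SchwartzMap V ℂ) x) := by
    rw [Real.fourier_eq]
    congr 1
    ext x
    rw [SchwartzMap.truncate_apply, hρ', Circle.smul_def, smul_eq_mul, ← integral_mul_const,
      ← integral_const_mul]
    congr 1
    ext v
    have : (-⟪x, ξ - S⁻¹ • v⟫ : ℝ) = -⟪x, ξ⟫ + ⟪v, S⁻¹ • x⟫ := by
      rw [inner_sub_right, inner_smul_right, inner_smul_right, real_inner_comm v x]; ring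
    rw [this, AddChar.map_add_eq_mul, Circle.coe_mul]
    ring
  rw [h1, integral_integral_swap]
  · congr 1
    ext v
    rw [integral_const_mul]
    congr 1
    have h : E = 𝓕 (𝓕⁻ E) := by simp
    conv_rhs => rw [h, SchwartzMap.fourier_coe, Real.fourier_eq]
    rfl
  · have := (Integrable.mul_prod (SchwartzMap.integrable (𝓕⁻ E : SchwartzMap V ℂ) (μ := volume))
      (SchwartzMap.integrable (𝓕 ρ : SchwartzMap V ℂ) (μ := volume)))
    refine this.mono ?_ (.of_forall fun z => ?_)
    · have h2 := (𝓕 ρ : SchwartzMap V ℂ).continuous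
      have h3 := (𝓕⁻ E : SchwartzMap V ℂ).continuous
      unfold Function.uncurry
      exact Continuous.aestronglyMeasurable (by fun_prop)
    · simp only [Function.uncurry]
      rw [norm_mul, norm_mul, norm_mul, Circle.norm_coe, one_mul, mul_comm]

lemma SchwartzMap.enorm_fourier_truncate_le {ρ : SchwartzMap V ℂ} (hρ : HasCompactSupport ρ) {S : ℝ}
    (hS : 0 < S) (E : SchwartzMap V ℂ) (ξ : V) :
    ‖𝓕 (⇑(SchwartzMap.truncate hρ hS E)) ξ‖ₑ ≤
      ∫⁻ v, ‖(𝓕 ρ : SchwartzMap V ℂ) v‖ₑ * ‖E (ξ - S⁻¹ • v)‖ₑ := by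
  rw [SchwartzMap.fourier_truncate]
  refine (enorm_integral_le_lintegral_enorm _).trans (le_of_eq ?_)
  simp_rw [enorm_mul]

lemma lintegral_enorm_fourier_truncate_le {ρ : SchwartzMap V ℂ} (hρ : HasCompactSupport ρ)
    {S : ℝ} (hS : 0 < S) (E : SchwartzMap V ℂ) :
    ∫⁻ ξ, ‖𝓕 (⇑(SchwartzMap.truncate hρ hS E)) ξ‖ₑ ≤
      (∫⁻ v, ‖(𝓕 ρ : SchwartzMap V ℂ) v‖ₑ) * ∫⁻ ξ, ‖E ξ‖ₑ := by
  have h2 := (𝓕 ρ : SchwartzMap V ℂ).continuous.measurable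
  have h3 := E.continuous.measurable
  refine (lintegral_mono (SchwartzMap.enorm_fourier_truncate_le hρ hS E)).trans ?_
  rw [lintegral_lintegral_swap (by unfold Function.uncurry; fun_prop), ← lintegral_mul_const _ (by fun_prop)]
  refine lintegral_mono fun v => ?_
  rw [lintegral_const_mul _ (by fun_prop)]
  rw [lintegral_sub_right_eq_self (fun ξ => ‖E ξ‖ₑ)]

lemma supIntegral_fourier_truncate_le (μ : Measure V) [IsProbabilityMeasure μ]
    {ρ : SchwartzMap V ℂ} (hρ : HasCompactSupport ρ)
    {S : ℝ} (hS : 0 < S) (E : SchwartzMap V ℂ) :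
    supIntegral μ (𝓕 (⇑(SchwartzMap.truncate hρ hS E))) ≤
      (∫⁻ v, ‖(𝓕 ρ : SchwartzMap V ℂ) v‖ₑ) * supIntegral μ E := by
  have h2 := (𝓕 ρ : SchwartzMap V ℂ).continuous.measurable
  have h3 := E.continuous.measurable
  refine iSup_le fun ξ => ?_
  refine (lintegral_mono fun η => SchwartzMap.enorm_fourier_truncate_le hρ hS E (ξ - η)).trans ?_
  rw [lintegral_lintegral_swap (by unfold Function.uncurry; fun_prop), ← lintegral_mul_const _ (by fun_prop)]
  refine lintegral_mono fun v => ?_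
  rw [lintegral_const_mul _ (by fun_prop)]
  gcongr
  refine le_trans (le_of_eq ?_) (le_iSup _ (ξ - S⁻¹ • v))
  congr 1
  ext η
  congr 2
  abel

lemma supIntegral_ne_top (μ : Measure V) [IsProbabilityMeasure μ] (E : SchwartzMap V ℂ) :
    supIntegral μ E ≠ ⊤ := by
  refine ne_top_of_le_ne_top (ENNReal.ofReal_ne_top (r := SchwartzMap.seminorm ℝ 0 0 E))
    (iSup_le fun ξ => ?_)
  calc _ ≤ ∫⁻ η, ENNReal.ofReal (SchwartzMap.seminorm ℝ 0 0 E) ∂μ := by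
        refine lintegral_mono fun η => ?_
        rw [← ofReal_norm]
        exact ENNReal.ofReal_le_ofReal (SchwartzMap.norm_le_seminorm ℝ _ _)
    _ = _ := by simp

lemma SchwartzMap.lintegral_enorm_ne_top (E : SchwartzMap V ℂ) : ∫⁻ ξ, ‖E ξ‖ₑ ≠ ⊤ :=
  (SchwartzMap.integrable E (μ := volume)).2.ne

/-- The `L^p → L^q` bound for convolution with `μ̌` times a compactly supported truncation. -/
lemma exists_eLpNorm_truncate_convolution_le (μ : Measure V) [IsProbabilityMeasure μ] {p q A : ℝ}
    (hp : 1 ≤ p) (hpq : p ≤ q) (hq : q ≤ 2) (hrestr : HasRestriction μ p A)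
    {ρ : SchwartzMap V ℂ} (hρ : HasCompactSupport ρ) :
    ∃ C : ℝ≥0∞, C ≠ ⊤ ∧ ∀ (S : ℝ) (hS : 0 < S) (E f : SchwartzMap V ℂ),
      eLpNorm ((fun x => measureFourierInv μ x * SchwartzMap.truncate hρ hS E x) ⋆[mul ℂ ℂ, volume] f)
        (ENNReal.ofReal q) volume ≤
      C * ENNReal.ofReal S ^ (Module.finrank ℝ V * (1 / q - 1 / 2)) *
        (supIntegral μ E * ∫⁻ ξ, ‖E ξ‖ₑ) ^ ((1 : ℝ) / 2) *
        eLpNorm f (ENNReal.ofReal p) volume := by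
  obtain ⟨r, hr, hρr⟩ : ∃ r : ℝ, 0 < r ∧ ∀ x, r < ‖x‖ → ρ x = 0 := by
    obtain ⟨r, hr, h⟩ := hρ.isCompact.isBounded.subset_closedBall_lt 0 0
    exact ⟨r, hr, fun x hx => image_eq_zero_of_notMem_tsupport fun hx' => by
      have := h hx'
      simp at this; linarith⟩
  set v := volume (Metric.closedBall (0 : V) (3 * r)) with hv
  have hvt : v ≠ ⊤ := measure_closedBall_lt_top.ne
  set P := ∫⁻ v, ‖(𝓕 ρ : SchwartzMap V ℂ) v‖ₑ with hP
  have hPt : P ≠ ⊤ := SchwartzMap.lintegral_enorm_ne_top _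
  have hq2 : 0 ≤ 1 / q - 1 / 2 := by
    rw [sub_nonneg]
    exact one_div_le_one_div_of_le (by linarith) hq
  refine ⟨3 ^ Module.finrank ℝ V * v ^ (1 / q - 1 / 2) * P * ENNReal.ofReal A, ?_, ?_⟩
  · exact ENNReal.mul_ne_top (ENNReal.mul_ne_top (ENNReal.mul_ne_top (by simp)
      (ENNReal.rpow_ne_top_of_nonneg hq2 hvt)) hPt) ENNReal.ofReal_ne_top
  intro S hS E f
  set κ := SchwartzMap.truncate hρ hS E with hκ
  have hs := supIntegral_fourier_truncate_le μ hρ hS E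
  have hl := lintegral_enorm_fourier_truncate_le hρ hS E
  have hst := supIntegral_ne_top μ E
  have hlt := SchwartzMap.lintegral_enorm_ne_top E
  rw [← hP] at hs hl
  have hmain := eLpNorm_convolution_le_of_support hp hpq hq
    (K := fun x => measureFourierInv μ x * κ x)
    ((continuous_measureFourierInv μ).mul κ.continuous) (S := S * r) (by positivity)
    (fun x hx => by
      simp only [hκ, SchwartzMap.truncate_apply]
      rw [hρr, zero_mul, mul_zero]
      rw [norm_smul, norm_inv, Real.norm_of_nonneg hS.le, ← div_eq_inv_mul, lt_div_iff₀ hS]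
      linarith)
    (B := (P * supIntegral μ E) * (P * ∫⁻ ξ, ‖E ξ‖ₑ) * ENNReal.ofReal A ^ 2)
    (ENNReal.mul_ne_top (ENNReal.mul_ne_top (ENNReal.mul_ne_top hPt hst)
      (ENNReal.mul_ne_top hPt hlt)) (by simp))
    (fun h hh => by
      refine (lintegral_convolution_sq_le μ hrestr κ h
        (SchwartzMap.hasCompactSupport_truncate hρ hS E) hh).trans ?_
      rw [mul_pow, ← mul_assoc]
      gcongr) f
  refine hmain.trans (le_of_eq ?_)
  have e1 : volume (Metric.closedBall (0 : V) (3 * (S * r))) =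
      ENNReal.ofReal S ^ (Module.finrank ℝ V) * v := by
    rw [show 3 * (S * r) = S * (3 * r) by ring, Measure.addHaar_closedBall_mul _ _ hS.le
      (by positivity), ENNReal.ofReal_pow hS.le]
  rw [e1, ENNReal.mul_rpow_of_nonneg _ _ hq2, ENNReal.rpow_mul, ENNReal.rpow_natCast]
  have e2 : (P * supIntegral μ E * (P * ∫⁻ ξ, ‖E ξ‖ₑ) * ENNReal.ofReal A ^ 2) =
      (supIntegral μ E * ∫⁻ ξ, ‖E ξ‖ₑ) * (P * ENNReal.ofReal A) ^ 2 := by ring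
  rw [e2, ENNReal.mul_rpow_of_nonneg _ _ (by norm_num), ← ENNReal.rpow_two, ← ENNReal.rpow_mul]
  norm_num
  ring

lemma convolution_measureFourierInv_mul_apply (μ : Measure V) (κ f : V → ℂ) (x : V) :
    ((fun x => measureFourierInv μ x * κ x) ⋆[mul ℂ ℂ, volume] f) x =
      ∫ t, measureFourierInv μ t * κ t * f (x - t) := rfl

lemma continuous_measureFourierInv_mul_convolution (μ : Measure V) [IsProbabilityMeasure μ]
    {κ : V → ℂ} (hκ : Integrable κ) (f : SchwartzMap V ℂ) :
    Continuous ((fun x => measureFourierInv μ x * κ x) ⋆[mul ℂ ℂ, volume] f) := by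
  refine BddAbove.continuous_convolution_right_of_integrable _ ?_ ?_ f.continuous
  · exact ⟨_, by rintro _ ⟨x, rfl⟩; exact SchwartzMap.norm_le_seminorm ℝ f x⟩
  · exact hκ.bdd_mul (continuous_measureFourierInv μ).aestronglyMeasurable
      (.of_forall (norm_measureFourierInv_le μ))

lemma integrable_measureFourierInv_mul_mul_sub (μ : Measure V) [IsProbabilityMeasure μ]
    {κ : V → ℂ} (hκ : Integrable κ) (f : SchwartzMap V ℂ) (x : V) :
    Integrable (fun t => measureFourierInv μ t * κ t * f (x - t)) := by
  have h1 : Integrable fun t => measureFourierInv μ t * κ t :=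
    hκ.bdd_mul (continuous_measureFourierInv μ).aestronglyMeasurable
      (.of_forall (norm_measureFourierInv_le μ))
  exact h1.mul_bdd (c := SchwartzMap.seminorm ℝ 0 0 f)
    (f.continuous.comp (continuous_const.sub continuous_id)).aestronglyMeasurable
    (.of_forall fun t => SchwartzMap.norm_le_seminorm ℝ f _)

lemma eLpNorm_const_mul_convolution_le (μ : Measure V) (c : ℝ) (κ f : V → ℂ) (r : ℝ≥0∞) :
    eLpNorm ((fun x => measureFourierInv μ x * ((c : ℂ) * κ x)) ⋆[mul ℂ ℂ, volume] f) r volume ≤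
      ENNReal.ofReal |c| *
        eLpNorm ((fun x => measureFourierInv μ x * κ x) ⋆[mul ℂ ℂ, volume] f) r volume := by
  have : ((fun x => measureFourierInv μ x * ((c : ℂ) * κ x)) ⋆[mul ℂ ℂ, volume] f) =
      (c : ℂ) • ((fun x => measureFourierInv μ x * κ x) ⋆[mul ℂ ℂ, volume] f) := by
    ext x
    rw [Pi.smul_apply, convolution_measureFourierInv_mul_apply,
      convolution_measureFourierInv_mul_apply, smul_eq_mul, ← integral_const_mul]
    congr 1
    ext t
    ring
  rw [this]
  refine eLpNorm_const_smul_le.trans (le_of_eq ?_)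
  rw [← ofReal_norm, Complex.norm_real, Real.norm_eq_abs]

/-- Convolution operators given by a boundedly converging series of kernels. -/
lemma eLpNorm_convolution_le_tsum (μ : Measure V) [IsProbabilityMeasure μ] {r : ℝ≥0∞} (hr : 1 ≤ r)
    {κ : ℕ → V → ℂ} (hκ : ∀ i, Continuous (κ i)) (hκi : ∀ i, Integrable (κ i)) {κ' : V → ℂ} {C : ℝ}
    (hlim : ∀ x, Tendsto (fun N => ∑ i ∈ Finset.range N, κ i x) atTop (nhds (κ' x)))
    (hC : ∀ N x, ‖∑ i ∈ Finset.range N, κ i x‖ ≤ C) (f : SchwartzMap V ℂ) {b : ℕ → ℝ≥0∞}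
    (hb : ∀ i, eLpNorm ((fun x => measureFourierInv μ x * κ i x) ⋆[mul ℂ ℂ, volume] f) r volume ≤
      b i) :
    eLpNorm ((fun x => measureFourierInv μ x * κ' x) ⋆[mul ℂ ℂ, volume] f) r volume ≤
      ∑' i, b i := by
  set F : ℕ → V → ℂ := fun i => ((fun x => measureFourierInv μ x * κ i x) ⋆[mul ℂ ℂ, volume] f)
    with hF
  have hFc : ∀ i, Continuous (F i) := fun i =>
    continuous_measureFourierInv_mul_convolution μ (hκi i) f
  have hsum : ∀ N x, (∑ i ∈ Finset.range N, F i) x =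
      ∫ t, measureFourierInv μ t * (∑ i ∈ Finset.range N, κ i t) * f (x - t) := by
    intro N x
    rw [Finset.sum_apply]
    simp only [hF, convolution_measureFourierInv_mul_apply]
    rw [← integral_finsetSum _ fun i _ => integrable_measureFourierInv_mul_mul_sub μ (hκi i) f x]
    congr 1
    ext t
    rw [Finset.mul_sum, Finset.sum_mul]
  have hpt : ∀ x, Tendsto (fun N => (∑ i ∈ Finset.range N, F i) x) atTop
      (nhds (((fun x => measureFourierInv μ x * κ' x) ⋆[mul ℂ ℂ, volume] f) x)) := by
    intro x
    simp_rw [hsum]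
    rw [convolution_measureFourierInv_mul_apply]
    refine tendsto_integral_of_dominated_convergence (fun t => 1 * C * ‖f (x - t)‖) ?_ ?_ ?_ ?_
    · intro N
      have h1 := continuous_measureFourierInv μ
      have h2 := f.continuous
      exact Continuous.aestronglyMeasurable (by fun_prop)
    · exact (f.integrable.norm.comp_sub_left x).const_mul _
    · refine fun N => .of_forall fun t => ?_
      rw [norm_mul, norm_mul]
      gcongr
      · exact norm_measureFourierInv_le μ t
      · exact hC N t
    · exact .of_forall fun t => ((hlim t).const_mul _).mul_const _
  refine (Lp.eLpNorm_lim_le_liminf_eLpNorm (fun N => ?_) _ (.of_forall hpt)).trans ?_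
  · exact Finset.aestronglyMeasurable_sum _ fun i _ => (hFc i).aestronglyMeasurable
  · refine liminf_le_of_frequently_le' (Frequently.of_forall fun N => ?_)
    refine (eLpNorm_sum_le (fun i _ => (hFc i).aestronglyMeasurable) hr).trans ?_
    exact (Finset.sum_le_sum fun i _ => hb i).trans (ENNReal.sum_le_tsum _)

lemma ContDiffBump.sub_comp_two_smul_eq_zero (φ : ContDiffBump (0 : V)) {x : V}
    (hx : ‖x‖ ≤ φ.rIn / 2) : φ x - φ ((2 : ℝ) • x) = 0 := by
  rw [φ.one_of_mem_closedBall, φ.one_of_mem_closedBall, sub_self]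
  · simp [norm_smul]; linarith
  · have := φ.rIn_pos
    simp; linarith

/-- The annular bump function `‖x‖ ^ s * (φ x - φ (2 x))`. -/
noncomputable def annulusBump (φ : ContDiffBump (0 : V)) (s : ℝ) (x : V) : ℂ :=
  ((‖x‖ ^ s * (φ x - φ ((2 : ℝ) • x)) : ℝ) : ℂ)

lemma contDiff_annulusBump (φ : ContDiffBump (0 : V)) (s : ℝ) :
    ContDiff ℝ ∞ (annulusBump φ s) := by
  refine Complex.ofRealCLM.contDiff.comp (contDiff_iff_contDiffAt.2 fun x => ?_)
  have h1 : ContDiff ℝ ∞ (fun x => φ x - φ ((2 : ℝ) • x)) :=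
    φ.contDiff.sub (φ.contDiff.comp (contDiff_const_smul _))
  by_cases hx : x = 0
  · subst hx
    refine (contDiffAt_const (c := (0 : ℝ))).congr_of_eventuallyEq ?_
    filter_upwards [Metric.ball_mem_nhds (0 : V) (half_pos φ.rIn_pos)] with y hy
    rw [φ.sub_comp_two_smul_eq_zero (by simpa using (Metric.mem_ball.1 hy).le)]
    exact mul_zero _
  · exact ((contDiffAt_norm ℝ hx).rpow_const_of_ne (norm_ne_zero_iff.2 hx)).mul h1.contDiffAt

lemma hasCompactSupport_annulusBump (φ : ContDiffBump (0 : V)) (s : ℝ) :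
    HasCompactSupport (annulusBump φ s) := by
  have h2 : HasCompactSupport (fun x : V => φ ((2 : ℝ) • x)) :=
    φ.hasCompactSupport.comp_homeomorph (Homeomorph.smulOfNeZero (2 : ℝ) two_ne_zero)
  have h1 : HasCompactSupport (fun x => φ x - φ ((2 : ℝ) • x)) := φ.hasCompactSupport.sub h2
  exact (h1.mul_left (f := fun x => ‖x‖ ^ s)).comp_left (g := fun r : ℝ => (r : ℂ)) (by simp)

/-- The operator `g ↦ 𝓕 (‖x‖ ^ (2 M) 𝓕⁻ g)`. -/
noncomputable def laplacePow (M : ℕ) : SchwartzMap V ℂ →L[ℂ] SchwartzMap V ℂ :=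
  (FourierTransform.fourierCLM ℂ (SchwartzMap V ℂ)).comp
    ((SchwartzMap.smulLeftCLM ℂ (fun x : V => ((‖x‖ ^ 2 : ℝ) : ℂ) ^ M)).comp
      (FourierTransform.fourierInvCLM ℂ (SchwartzMap V ℂ)))

lemma hasTemperateGrowth_norm_sq_pow (M : ℕ) :
    Function.HasTemperateGrowth (fun x : V => ((‖x‖ ^ 2 : ℝ) : ℂ) ^ M) :=
  (Function.HasTemperateGrowth.comp Function.Complex.hasTemperateGrowth_ofReal
    (Function.hasTemperateGrowth_norm_sq (H := V))).pow M

lemma fourierInv_laplacePow (M : ℕ) (g : SchwartzMap V ℂ) (x : V) :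
    (𝓕⁻ (laplacePow M g) : SchwartzMap V ℂ) x =
      ((‖x‖ ^ (2 * M) : ℝ) : ℂ) * (𝓕⁻ g : SchwartzMap V ℂ) x := by
  simp only [laplacePow, ContinuousLinearMap.comp_apply, FourierTransform.fourierCLM_apply,
    FourierTransform.fourierInvCLM_apply, FourierTransform.fourierInv_fourier_eq]
  rw [SchwartzMap.smulLeftCLM_apply_apply (hasTemperateGrowth_norm_sq_pow M), smul_eq_mul, pow_mul]
  push_cast
  rfl

/-- The `L^p → L^q` bound for convolution with `μ̌` times the kernel `𝓕⁻ g`, in terms of the sizes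
of `g` and of its iterated Laplacian. -/
lemma exists_eLpNorm_fourierInv_convolution_le (μ : Measure V) [IsProbabilityMeasure μ] {p q A : ℝ}
    (hp : 1 ≤ p) (hpq : p ≤ q) (hq : q ≤ 2) (hrestr : HasRestriction μ p A) {M : ℕ}
    (hM : Module.finrank ℝ V < M) :
    ∃ C : ℝ≥0∞, C ≠ ⊤ ∧ ∀ (R : ℝ), 0 < R → ∀ g f : SchwartzMap V ℂ,
      eLpNorm ((fun x => measureFourierInv μ x * (𝓕⁻ g : SchwartzMap V ℂ) x) ⋆[mul ℂ ℂ, volume] f)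
        (ENNReal.ofReal q) volume ≤
      C * ENNReal.ofReal (R ^ (Module.finrank ℝ V * (1 / q - 1 / 2))) *
        ((supIntegral μ g * ∫⁻ ξ, ‖g ξ‖ₑ) ^ ((1 : ℝ) / 2) +
          ENNReal.ofReal (R ^ (-(2 * M : ℝ))) *
          (supIntegral μ (laplacePow M g) * ∫⁻ ξ, ‖laplacePow M g ξ‖ₑ) ^ ((1 : ℝ) / 2)) *
        eLpNorm f (ENNReal.ofReal p) volume := by
  let φ : ContDiffBump (0 : V) := ⟨1, 2, one_pos, one_lt_two⟩
  have hφs : HasCompactSupport (fun x => (φ x : ℂ)) :=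
    φ.hasCompactSupport.comp_left (g := fun r : ℝ => (r : ℂ)) (by simp)
  let ρ₀ : SchwartzMap V ℂ := hφs.toSchwartzMap (Complex.ofRealCLM.contDiff.comp φ.contDiff)
  have hρ₀ : HasCompactSupport ρ₀ := hφs
  let ρ₁ : SchwartzMap V ℂ := (hasCompactSupport_annulusBump φ (-(2 * M : ℝ))).toSchwartzMap
    (contDiff_annulusBump φ _)
  have hρ₁ : HasCompactSupport ρ₁ := hasCompactSupport_annulusBump φ (-(2 * M : ℝ))
  have hρ₀a : ∀ x, ρ₀ x = (φ x : ℂ) := fun x => rfl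
  have hρ₁a : ∀ x, ρ₁ x = ((‖x‖ ^ (-(2 * M : ℝ)) * (φ x - φ ((2 : ℝ) • x)) : ℝ) : ℂ) :=
    fun x => rfl
  clear_value ρ₀ ρ₁
  obtain ⟨C₀, hC₀t, hC₀⟩ := exists_eLpNorm_truncate_convolution_le μ hp hpq hq hrestr hρ₀
  obtain ⟨C₁, hC₁t, hC₁⟩ := exists_eLpNorm_truncate_convolution_le μ hp hpq hq hrestr hρ₁
  refine ⟨C₀ + C₁, ENNReal.add_ne_top.2 ⟨hC₀t, hC₁t⟩, fun R hR g f => ?_⟩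
  set a : ℝ := Module.finrank ℝ V * (1 / q - 1 / 2) with ha
  have hq1 : 1 ≤ q := hp.trans hpq
  have ha1 : a - 2 * M ≤ -1 := by
    have h1 : 1 / q ≤ 1 := by rw [div_le_one (by linarith)]; exact hq1
    have h2 : (Module.finrank ℝ V : ℝ) + 1 ≤ M := by exact_mod_cast hM
    have h3 : a ≤ Module.finrank ℝ V * 1 := by
      rw [ha]
      gcongr
      linarith
    have : (0 : ℝ) ≤ Module.finrank ℝ V := by positivity
    linarith
  have hS : ∀ i : ℕ, 0 < 2 ^ i * R := fun i => by positivity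
  let κ : ℕ → V → ℂ := fun i => match i with
    | 0 => SchwartzMap.truncate hρ₀ hR g
    | i + 1 => fun x => (((2 ^ (i + 1) * R) ^ (-(2 * M : ℝ)) : ℝ) : ℂ) *
        SchwartzMap.truncate hρ₁ (hS (i + 1)) (laplacePow M g) x
  have hκs : ∀ i x, κ (i + 1) x =
      ((φ ((2 ^ (i + 1) * R)⁻¹ • x) - φ ((2 ^ i * R)⁻¹ • x) : ℝ) : ℂ) *
        (𝓕⁻ g : SchwartzMap V ℂ) x := by
    intro i x
    simp only [κ]
    rw [SchwartzMap.truncate_apply, hρ₁a, fourierInv_laplacePow, smul_smul]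
    have e1 : (2 : ℝ) * (2 ^ (i + 1) * R)⁻¹ = (2 ^ i * R)⁻¹ := by
      rw [pow_succ]; field_simp
    rw [e1]
    by_cases hx : x = 0
    · subst hx
      simp
    · rw [← mul_assoc, ← mul_assoc, ← Complex.ofReal_mul, ← Complex.ofReal_mul]
      congr 2
      have hx' : 0 < ‖x‖ := norm_pos_iff.2 hx
      have hSi := hS (i + 1)
      obtain ⟨S₁, hS₁⟩ : ∃ s, s = 2 ^ (i + 1) * R := ⟨_, rfl⟩
      rw [← hS₁] at hSi ⊢
      rw [norm_smul, Real.norm_of_nonneg (by positivity),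
        Real.mul_rpow (by positivity) (by positivity), Real.inv_rpow hSi.le,
        ← mul_assoc, ← mul_assoc,
        mul_inv_cancel₀ (Real.rpow_pos_of_pos hSi _).ne', one_mul, mul_right_comm]
      have : ‖x‖ ^ (-(2 * M : ℝ)) * ‖x‖ ^ (2 * M) = 1 := by
        rw [← Real.rpow_natCast, ← Real.rpow_add hx']
        push_cast
        simp
      rw [this, one_mul]
  have hpartial : ∀ N x, ∑ i ∈ Finset.range (N + 1), κ i x =
      (φ ((2 ^ N * R)⁻¹ • x) : ℂ) * (𝓕⁻ g : SchwartzMap V ℂ) x := by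
    intro N x
    induction N with
    | zero => simp [κ, SchwartzMap.truncate_apply, hρ₀a]
    | succ N ih =>
      rw [Finset.sum_range_succ, ih, hκs]
      push_cast
      ring
  have hgb := fun x => SchwartzMap.norm_le_seminorm ℝ (𝓕⁻ g : SchwartzMap V ℂ) x
  have hmain := eLpNorm_convolution_le_tsum μ (r := ENNReal.ofReal q) (by simpa using hq1)
    (κ := κ) (κ' := (𝓕⁻ g : SchwartzMap V ℂ)) (f := f)
    (C := SchwartzMap.seminorm ℝ 0 0 (𝓕⁻ g : SchwartzMap V ℂ))
    (b := fun i => match i with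
      | 0 => C₀ * ENNReal.ofReal R ^ a * (supIntegral μ g * ∫⁻ ξ, ‖g ξ‖ₑ) ^ ((1 : ℝ) / 2) *
          eLpNorm f (ENNReal.ofReal p) volume
      | i + 1 => ENNReal.ofReal |(2 ^ (i + 1) * R) ^ (-(2 * M : ℝ))| *
          (C₁ * ENNReal.ofReal (2 ^ (i + 1) * R) ^ a *
          (supIntegral μ (laplacePow M g) * ∫⁻ ξ, ‖laplacePow M g ξ‖ₑ) ^ ((1 : ℝ) / 2) *
          eLpNorm f (ENNReal.ofReal p) volume))
    ?_ ?_ ?_ ?_ ?_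
  rotate_left
  · rintro (_ | i)
    · exact SchwartzMap.continuous _
    · exact continuous_const.mul (SchwartzMap.continuous _)
  · rintro (_ | i)
    · exact SchwartzMap.integrable _
    · exact (SchwartzMap.integrable _).const_mul _
  · intro x
    rw [← tendsto_add_atTop_iff_nat 1]
    simp_rw [hpartial]
    have h1 : Tendsto (fun N : ℕ => (2 ^ N * R)⁻¹ • x) atTop (nhds ((0 : ℝ) • x)) := by
      refine Tendsto.smul_const (tendsto_inv_atTop_zero.comp ?_) x
      exact (tendsto_pow_atTop_atTop_of_one_lt one_lt_two).atTop_mul_const hR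
    rw [zero_smul] at h1
    have h2 : φ (0 : V) = 1 := φ.one_of_mem_closedBall (by simp [φ.rIn_pos.le])
    have h3 := (Complex.continuous_ofReal.tendsto _).comp ((φ.continuous.tendsto 0).comp h1)
    rw [h2] at h3
    simpa using h3.mul_const ((𝓕⁻ g : SchwartzMap V ℂ) x)
  · rintro (_ | N) x
    · simp
    · rw [hpartial, norm_mul, Complex.norm_real, Real.norm_of_nonneg φ.nonneg]
      exact (mul_le_of_le_one_left (norm_nonneg _) φ.le_one).trans (hgb x)
  · rintro (_ | i)
    · exact hC₀ R hR g f
    · refine (eLpNorm_const_mul_convolution_le μ _ _ _ _).trans ?_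
      refine mul_le_mul' le_rfl ?_
      exact hC₁ _ (hS (i + 1)) (laplacePow M g) f
  refine hmain.trans ?_
  rw [tsum_eq_zero_add' ENNReal.summable]
  simp only
  generalize (supIntegral μ g * ∫⁻ ξ, ‖g ξ‖ₑ) ^ ((1 : ℝ) / 2) = X₀
  generalize (supIntegral μ (laplacePow M g) * ∫⁻ ξ, ‖laplacePow M g ξ‖ₑ) ^ ((1 : ℝ) / 2) = X₁
  generalize eLpNorm f (ENNReal.ofReal p) volume = N
  have hterm : ∀ i : ℕ, ENNReal.ofReal |(2 ^ (i + 1) * R) ^ (-(2 * M : ℝ))| *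
          (C₁ * ENNReal.ofReal (2 ^ (i + 1) * R) ^ a * X₁ * N) ≤
        (2⁻¹ : ℝ≥0∞) ^ (i + 1) * (C₁ * ENNReal.ofReal (R ^ a) *
          (ENNReal.ofReal (R ^ (-(2 * M : ℝ))) * X₁) * N) := by
    intro i
    have h1 : ENNReal.ofReal |(2 ^ (i + 1) * R) ^ (-(2 * M : ℝ))| *
        ENNReal.ofReal (2 ^ (i + 1) * R) ^ a ≤
        (2⁻¹ : ℝ≥0∞) ^ (i + 1) * (ENNReal.ofReal (R ^ a) * ENNReal.ofReal (R ^ (-(2 * M : ℝ)))) := by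
      have e2 : (2⁻¹ : ℝ≥0∞) = ENNReal.ofReal (2⁻¹) := by
        rw [ENNReal.ofReal_inv_of_pos two_pos]; simp
      rw [ENNReal.ofReal_rpow_of_pos (hS _), ← ENNReal.ofReal_mul (abs_nonneg _), e2,
        ← ENNReal.ofReal_pow (by norm_num), ← ENNReal.ofReal_mul (by positivity),
        ← ENNReal.ofReal_mul (by positivity)]
      apply ENNReal.ofReal_le_ofReal
      rw [abs_of_nonneg (by positivity), ← Real.rpow_add (hS _), ← Real.rpow_add hR,
        Real.mul_rpow (by positivity) hR.le]
      have e3 : a + -(2 * (M:ℝ)) = -(2 * M) + a := by ring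
      rw [e3]
      gcongr
      rw [inv_pow, ← Real.rpow_neg_one]
      exact Real.rpow_le_rpow_of_exponent_le (one_le_pow₀ one_le_two) (by linarith)
    calc _ = (ENNReal.ofReal |(2 ^ (i + 1) * R) ^ (-(2 * M : ℝ))| *
        ENNReal.ofReal (2 ^ (i + 1) * R) ^ a) * (C₁ * X₁ * N) := by ring
      _ ≤ ((2⁻¹ : ℝ≥0∞) ^ (i + 1) * (ENNReal.ofReal (R ^ a) * ENNReal.ofReal (R ^ (-(2 * M : ℝ))))) *
          (C₁ * X₁ * N) := by gcongr
      _ = _ := by ring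
  have hgeo : ∑' i : ℕ, (2⁻¹ : ℝ≥0∞) ^ (i + 1) = 1 := by
    rw [ENNReal.tsum_geometric_add_one, ENNReal.one_sub_inv_two, inv_inv]
    exact ENNReal.inv_mul_cancel (by simp) (by simp)
  calc _ ≤ C₀ * ENNReal.ofReal R ^ a * X₀ * N + ∑' i : ℕ, (2⁻¹ : ℝ≥0∞) ^ (i + 1) *
        (C₁ * ENNReal.ofReal (R ^ a) * (ENNReal.ofReal (R ^ (-(2 * M : ℝ))) * X₁) * N) := by
        exact add_le_add le_rfl (ENNReal.tsum_le_tsum hterm)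
    _ = C₀ * ENNReal.ofReal (R ^ a) * X₀ * N +
        C₁ * ENNReal.ofReal (R ^ a) * (ENNReal.ofReal (R ^ (-(2 * M : ℝ))) * X₁) * N := by
        rw [ENNReal.tsum_mul_right, hgeo, one_mul, ENNReal.ofReal_rpow_of_pos hR]
    _ ≤ (C₀ + C₁) * ENNReal.ofReal (R ^ a) * X₀ * N +
        (C₀ + C₁) * ENNReal.ofReal (R ^ a) * (ENNReal.ofReal (R ^ (-(2 * M : ℝ))) * X₁) * N := by
        gcongr
        · exact le_self_add
        · exact le_add_self
    _ = _ := by ring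

/-- A bounded family of Schwartz functions has bounded image under continuous linear operators. -/
lemma SchwartzMap.exists_one_add_norm_pow_mul_le {ι : Type*} {B : ι → SchwartzMap V ℂ}
    (hB : ∀ k m : ℕ, ∃ C, ∀ i, SchwartzMap.seminorm ℂ k m (B i) ≤ C)
    (L : SchwartzMap V ℂ →L[ℂ] SchwartzMap V ℂ) (k : ℕ) :
    ∃ C, 0 ≤ C ∧ ∀ i x, (1 + ‖x‖) ^ k * ‖L (B i) x‖ ≤ C := by
  have key : ∀ j : ℕ, ∃ C, 0 ≤ C ∧ ∀ i, SchwartzMap.seminorm ℂ j 0 (L (B i)) ≤ C := by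
    intro j
    have hc : Continuous ((SchwartzMap.seminorm ℂ j 0).comp
        (L : SchwartzMap V ℂ →ₗ[ℂ] SchwartzMap V ℂ)) :=
      ((schwartz_withSeminorms ℂ V ℂ).continuous_seminorm (j, 0)).comp L.continuous
    obtain ⟨s, C, -, hC⟩ := Seminorm.bound_of_continuous (schwartz_withSeminorms ℂ V ℂ) _ hc
    choose D hD using hB
    refine ⟨C * ∑ i ∈ s, |D i.1 i.2|, by positivity, fun i => (hC (B i)).trans ?_⟩
    rw [smul_apply, NNReal.smul_def, smul_eq_mul]
    gcongr
    refine (Seminorm.finset_sup_le_sum _ s (B i)).trans ?_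
    rw [sum_apply]
    exact Finset.sum_le_sum fun j _ => (hD j.1 j.2 i).trans (le_abs_self _)
  obtain ⟨C, hC0, hC⟩ := key k
  obtain ⟨D, hD0, hD⟩ := key 0
  refine ⟨2 ^ (k - 1) * (D + C), by positivity, fun i x => ?_⟩
  have h1 := add_pow_le zero_le_one (norm_nonneg x) k
  have h2 : ‖x‖ ^ k * ‖L (B i) x‖ ≤ C :=
    (SchwartzMap.norm_pow_mul_le_seminorm ℂ (L (B i)) k x).trans (hC i)
  have h3 : ‖L (B i) x‖ ≤ D := (SchwartzMap.norm_le_seminorm ℂ (L (B i)) x).trans (hD i)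
  calc _ ≤ (2 ^ (k - 1) * (1 ^ k + ‖x‖ ^ k)) * ‖L (B i) x‖ := by gcongr
    _ = 2 ^ (k - 1) * (‖L (B i) x‖ + ‖x‖ ^ k * ‖L (B i) x‖) := by ring
    _ ≤ _ := by gcongr

/-- The dilation `g ↦ g (t • ·)` on Schwartz space. -/
noncomputable def SchwartzMap.dilate {t : ℝ} (ht : 0 < t) : SchwartzMap V ℂ →L[ℂ] SchwartzMap V ℂ :=
  SchwartzMap.compCLMOfContinuousLinearEquiv ℂ
    (ContinuousLinearEquiv.smulLeft (Units.mk0 t ht.ne') : V ≃L[ℝ] V)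

lemma SchwartzMap.dilate_apply {t : ℝ} (ht : 0 < t) (g : SchwartzMap V ℂ) (x : V) :
    SchwartzMap.dilate ht g x = g (t • x) := rfl

lemma SchwartzMap.fourierInv_dilate {t : ℝ} (ht : 0 < t) (g : SchwartzMap V ℂ) (x : V) :
    (𝓕⁻ (SchwartzMap.dilate ht g) : SchwartzMap V ℂ) x =
      ((t ^ Module.finrank ℝ V)⁻¹ : ℝ) • (𝓕⁻ g : SchwartzMap V ℂ) (t⁻¹ • x) := by
  rw [SchwartzMap.fourierInv_coe, SchwartzMap.fourierInv_coe, Real.fourierInv_eq,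
    Real.fourierInv_eq]
  have := Measure.integral_comp_smul (volume : Measure V)
    (fun v => Real.fourierChar ⟪v, t⁻¹ • x⟫ • g v) t
  rw [abs_of_pos (by positivity)] at this
  rw [← this]
  congr 1
  ext v
  rw [SchwartzMap.dilate_apply, inner_smul_left, inner_smul_right]
  simp [ht.ne']

lemma laplacePow_dilate (M : ℕ) {t : ℝ} (ht : 0 < t) (g : SchwartzMap V ℂ) :
    laplacePow M (SchwartzMap.dilate ht g) =
      ((t ^ (2 * M) : ℝ) : ℂ) • SchwartzMap.dilate ht (laplacePow M g) := by
  have h : Function.Injective (fun f : SchwartzMap V ℂ => (𝓕⁻ f : SchwartzMap V ℂ)) := by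
    intro f g hfg
    have := congrArg (fun f : SchwartzMap V ℂ => (𝓕 f : SchwartzMap V ℂ)) hfg
    simpa using this
  apply h
  ext x
  simp only [FourierTransform.fourierInv_smul, smul_apply]
  rw [fourierInv_laplacePow, SchwartzMap.fourierInv_dilate, SchwartzMap.fourierInv_dilate,
    fourierInv_laplacePow, norm_smul, mul_pow, Real.norm_of_nonneg (by positivity)]
  simp only [Complex.real_smul, smul_eq_mul]
  have : (t:ℂ) ≠ 0 := by exact_mod_cast ht.ne'
  push_cast
  rw [inv_pow]
  field_simp

/-- The integrable weight `(1 + ‖x‖) ^ (-(n + 1))` on an `n`-dimensional space. -/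
noncomputable def decayWeight (x : V) : ℝ≥0∞ :=
  ENNReal.ofReal ((1 + ‖x‖) ^ (-(Module.finrank ℝ V + 1 : ℝ)))

lemma measurable_decayWeight : Measurable (decayWeight : V → ℝ≥0∞) := by
  unfold decayWeight
  fun_prop

lemma lintegral_decayWeight_ne_top : ∫⁻ x : V, decayWeight x ≠ ⊤ :=
  (finite_integral_one_add_norm (E := V) (μ := volume) (by linarith)).ne

lemma decayWeight_le {x w : V} (h : ‖w - x‖ ≤ 1) :
    decayWeight x ≤ ENNReal.ofReal (2 ^ (Module.finrank ℝ V + 1 : ℝ)) * decayWeight w := by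
  unfold decayWeight
  rw [← ENNReal.ofReal_mul (by positivity)]
  apply ENNReal.ofReal_le_ofReal
  have hx : 0 < 1 + ‖x‖ := by positivity
  have hw : 0 < 1 + ‖w‖ := by positivity
  rw [Real.rpow_neg hx.le, Real.rpow_neg hw.le, ← div_eq_mul_inv, inv_eq_one_div,
    div_le_div_iff₀ (by positivity) (by positivity), one_mul,
    ← Real.mul_rpow (by positivity) (by positivity)]
  have : ‖w‖ ≤ ‖x‖ + ‖w - x‖ := by simpa using norm_add_le x (w - x)
  apply Real.rpow_le_rpow hw.le (by linarith [norm_nonneg x]) (by positivity)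

lemma lintegral_decayWeight_smul {t : ℝ} (ht : 0 < t) :
    ∫⁻ x : V, decayWeight (t • x) =
      ENNReal.ofReal ((t ^ Module.finrank ℝ V)⁻¹) * ∫⁻ x : V, decayWeight x := by
  have h := lintegral_map (μ := (volume : Measure V)) (measurable_decayWeight (V := V))
    (measurable_const_smul t)
  rw [← h, Measure.map_addHaar_smul _ ht.ne', lintegral_smul_measure,
    abs_of_pos (by positivity), smul_eq_mul]

lemma exists_lintegral_decayWeight_le (μ : Measure V) [IsProbabilityMeasure μ] :
    ∃ C : ℝ≥0∞, C ≠ ⊤ ∧ ∀ t : ℝ, 0 < t → ∀ ξ : V,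
      ∫⁻ η, decayWeight (t • (ξ - η)) ∂μ ≤ C * ⨆ x, μ (Metric.closedBall x t⁻¹) := by
  obtain ⟨v, hv⟩ : ∃ v, v = volume (Metric.closedBall (0 : V) 1) := ⟨_, rfl⟩
  have hv0 : v ≠ 0 := hv ▸ (Metric.measure_closedBall_pos _ _ one_pos).ne'
  have hvt : v ≠ ⊤ := hv ▸ measure_closedBall_lt_top.ne
  obtain ⟨D, hD⟩ : ∃ D, D = ENNReal.ofReal (2 ^ (Module.finrank ℝ V + 1 : ℝ)) := ⟨_, rfl⟩
  refine ⟨v⁻¹ * (D * ∫⁻ x : V, decayWeight x), ENNReal.mul_ne_top (by simpa using hv0)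
    (ENNReal.mul_ne_top (by simp [hD]) lintegral_decayWeight_ne_top), fun t ht ξ => ?_⟩
  have h1 : ∀ x : V, v * decayWeight x ≤
      ∫⁻ w, (Metric.closedBall x 1).indicator (fun w => D * decayWeight w) w := by
    intro x
    rw [lintegral_indicator measurableSet_closedBall]
    calc v * decayWeight x = ∫⁻ w in Metric.closedBall x 1, decayWeight x := by
          rw [setLIntegral_const, mul_comm, hv, Measure.addHaar_closedBall_center volume x]
      _ ≤ _ := setLIntegral_mono (measurable_decayWeight.const_mul _) fun w hw => by
          rw [hD]
          exact decayWeight_le (by simpa [dist_eq_norm] using hw)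
  have hmeas : Measurable (Function.uncurry fun (η w : V) =>
      (Metric.closedBall (t • (ξ - η)) 1).indicator (fun w => D * decayWeight w) w) := by
    have hS : MeasurableSet {z : V × V | dist z.2 (t • (ξ - z.1)) ≤ 1} :=
      measurableSet_le (by fun_prop) measurable_const
    exact ((measurable_decayWeight.comp measurable_snd).const_mul D).indicator hS
  have h2 : v * ∫⁻ η, decayWeight (t • (ξ - η)) ∂μ ≤
      (D * ∫⁻ x : V, decayWeight x) * ⨆ x, μ (Metric.closedBall x t⁻¹) := by
    have hm1 : Measurable fun η : V => decayWeight (t • (ξ - η)) :=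
      measurable_decayWeight.comp (by fun_prop)
    rw [← lintegral_const_mul _ hm1]
    refine (lintegral_mono fun η => h1 _).trans ?_
    rw [lintegral_lintegral_swap hmeas.aemeasurable]
    rw [← lintegral_const_mul _ measurable_decayWeight,
      ← lintegral_mul_const _ (measurable_decayWeight.const_mul _)]
    refine lintegral_mono fun w => ?_
    have h3 : ∀ η, (Metric.closedBall (t • (ξ - η)) 1).indicator (fun w => D * decayWeight w) w =
        (Metric.closedBall (ξ - t⁻¹ • w) t⁻¹).indicator (fun _ => D * decayWeight w) η := by
      intro η
      simp only [Set.indicator, Metric.mem_closedBall, dist_eq_norm]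
      congr 1
      have h4 : w - t • (ξ - η) = t • (η - (ξ - t⁻¹ • w)) := by
        simp only [smul_sub, smul_smul, mul_inv_cancel₀ ht.ne', one_smul]
        abel
      rw [h4, norm_smul, Real.norm_of_nonneg ht.le, ← le_div_iff₀' ht, one_div]
    simp_rw [h3]
    rw [lintegral_indicator_const measurableSet_closedBall]
    gcongr
    exact le_iSup (fun x => μ (Metric.closedBall x t⁻¹)) _
  calc _ = v⁻¹ * (v * ∫⁻ η, decayWeight (t • (ξ - η)) ∂μ) := by
        rw [← mul_assoc, ENNReal.inv_mul_cancel hv0 hvt, one_mul]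
    _ ≤ v⁻¹ * ((D * ∫⁻ x : V, decayWeight x) * ⨆ x, μ (Metric.closedBall x t⁻¹)) := by gcongr
    _ = _ := by ring

lemma supIntegral_mul_lintegral_dilate_le (μ : Measure V) [IsProbabilityMeasure μ] {E D : ℝ≥0∞}
    {t : ℝ} (ht : 0 < t) {G : SchwartzMap V ℂ} (hG : ∀ x, ‖G x‖ₑ ≤ D * decayWeight x)
    (hE : ∀ ξ : V, ∫⁻ η, decayWeight (t • (ξ - η)) ∂μ ≤ E * ⨆ x, μ (Metric.closedBall x t⁻¹)) :
    (supIntegral μ (SchwartzMap.dilate ht G) *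
        ∫⁻ ξ, ‖SchwartzMap.dilate ht G ξ‖ₑ) ^ ((1 : ℝ) / 2) ≤
      D * (E * ∫⁻ x : V, decayWeight x) ^ ((1 : ℝ) / 2) *
        ENNReal.ofReal (t ^ (-(Module.finrank ℝ V / 2 : ℝ))) *
        (⨆ x, μ (Metric.closedBall x t⁻¹)) ^ ((1 : ℝ) / 2) := by
  have h1 : supIntegral μ (SchwartzMap.dilate ht G) ≤
      D * (E * ⨆ x, μ (Metric.closedBall x t⁻¹)) := by
    refine iSup_le fun ξ => ?_
    have hm1 : Measurable fun η : V => decayWeight (t • (ξ - η)) :=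
      measurable_decayWeight.comp (by fun_prop)
    calc _ ≤ ∫⁻ η, D * decayWeight (t • (ξ - η)) ∂μ := lintegral_mono fun η => hG _
      _ = D * ∫⁻ η, decayWeight (t • (ξ - η)) ∂μ := lintegral_const_mul _ hm1
      _ ≤ _ := by gcongr; exact hE ξ
  have h2 : ∫⁻ ξ, ‖SchwartzMap.dilate ht G ξ‖ₑ ≤
      D * (ENNReal.ofReal ((t ^ Module.finrank ℝ V)⁻¹) * ∫⁻ x : V, decayWeight x) := by
    have hm1 : Measurable fun x : V => decayWeight (t • x) :=
      measurable_decayWeight.comp (by fun_prop)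
    rw [← lintegral_decayWeight_smul ht, ← lintegral_const_mul _ hm1]
    exact lintegral_mono fun ξ => hG _
  generalize (∫⁻ x : V, decayWeight x) = W at *
  generalize (⨆ x, μ (Metric.closedBall x t⁻¹)) = S at *
  have h3 : ENNReal.ofReal (t ^ (-(Module.finrank ℝ V / 2 : ℝ))) =
      (ENNReal.ofReal ((t ^ Module.finrank ℝ V)⁻¹)) ^ ((1 : ℝ) / 2) := by
    rw [ENNReal.ofReal_rpow_of_pos (by positivity), ← Real.rpow_natCast, ← Real.rpow_neg ht.le,
      ← Real.rpow_mul ht.le]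
    congr 2
    ring
  have hhalf : (0 : ℝ) ≤ 1 / 2 := by norm_num
  have h4 : D = (D * D) ^ ((1 : ℝ) / 2) := by
    rw [ENNReal.mul_rpow_of_nonneg _ _ hhalf, ← ENNReal.rpow_add_of_nonneg _ _ hhalf hhalf]
    norm_num
  rw [h3]
  nth_rw 1 [h4]
  rw [← ENNReal.mul_rpow_of_nonneg _ _ hhalf, ← ENNReal.mul_rpow_of_nonneg _ _ hhalf,
    ← ENNReal.mul_rpow_of_nonneg _ _ hhalf]
  refine ENNReal.rpow_le_rpow ((mul_le_mul' h1 h2).trans_eq ?_) hhalf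
  ring

/-- Uniform `L^p → L^q` bounds for convolution with `μ̌` times a dilated kernel. -/
lemma exists_eLpNorm_fourierInv_dilate_convolution_le (μ : Measure V) [IsProbabilityMeasure μ]
    {p q A : ℝ} (hp : 1 ≤ p) (hpq : p ≤ q) (hq : q ≤ 2) (hrestr : HasRestriction μ p A)
    {ι : Type*} {B : ι → SchwartzMap V ℂ}
    (hB : ∀ k m : ℕ, ∃ C, ∀ i, SchwartzMap.seminorm ℂ k m (B i) ≤ C) :
    ∃ C : ℝ≥0∞, C ≠ ⊤ ∧ ∀ (i : ι) (t : ℝ) (ht : 0 < t) (f : SchwartzMap V ℂ),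
      eLpNorm ((fun x => measureFourierInv μ x *
        (𝓕⁻ (SchwartzMap.dilate ht (B i)) : SchwartzMap V ℂ) x) ⋆[mul ℂ ℂ, volume] f)
        (ENNReal.ofReal q) volume ≤
      C * ENNReal.ofReal (t ^ (Module.finrank ℝ V * (1 / q - 1 / 2) - Module.finrank ℝ V / 2)) *
        (⨆ x, μ (Metric.closedBall x t⁻¹)) ^ ((1 : ℝ) / 2) *
        eLpNorm f (ENNReal.ofReal p) volume := by
  obtain ⟨M, hM⟩ : ∃ M : ℕ, M = Module.finrank ℝ V + 1 := ⟨_, rfl⟩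
  obtain ⟨K, hKt, hK⟩ := exists_eLpNorm_fourierInv_convolution_le μ hp hpq hq hrestr
    (show Module.finrank ℝ V < M by omega)
  obtain ⟨E, hEt, hE⟩ := exists_lintegral_decayWeight_le μ
  obtain ⟨D₀, -, hD₀⟩ := SchwartzMap.exists_one_add_norm_pow_mul_le hB
    (ContinuousLinearMap.id ℂ _) (Module.finrank ℝ V + 1)
  obtain ⟨D₁, -, hD₁⟩ := SchwartzMap.exists_one_add_norm_pow_mul_le hB
    (laplacePow M) (Module.finrank ℝ V + 1)
  have hdecay : ∀ {D : ℝ} {x : V} {z : ℂ}, (1 + ‖x‖) ^ (Module.finrank ℝ V + 1) * ‖z‖ ≤ D →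
      ‖z‖ₑ ≤ ENNReal.ofReal D * decayWeight x := by
    intro D x z h
    have h1 : 0 < (1 + ‖x‖) ^ (Module.finrank ℝ V + 1) := by positivity
    have h2 : 0 ≤ D := le_trans (by positivity) h
    rw [decayWeight, ← ENNReal.ofReal_mul h2, ← ofReal_norm]
    apply ENNReal.ofReal_le_ofReal
    rw [Real.rpow_neg (by positivity), ← div_eq_mul_inv]
    have e : (1 + ‖x‖) ^ (Module.finrank ℝ V + 1 : ℝ) = (1 + ‖x‖) ^ (Module.finrank ℝ V + 1) := by
      rw [← Real.rpow_natCast]; push_cast; rfl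
    rw [e, le_div_iff₀ h1]
    linarith
  refine ⟨K * ((ENNReal.ofReal D₀ + ENNReal.ofReal D₁) *
    (E * ∫⁻ x : V, decayWeight x) ^ ((1 : ℝ) / 2)), ?_, fun i t ht f => ?_⟩
  · refine ENNReal.mul_ne_top hKt (ENNReal.mul_ne_top (by simp) ?_)
    exact ENNReal.rpow_ne_top_of_nonneg (by norm_num)
      (ENNReal.mul_ne_top hEt lintegral_decayWeight_ne_top)
  refine (hK t ht (SchwartzMap.dilate ht (B i)) f).trans ?_
  rw [laplacePow_dilate, ← map_smul]
  have h0 := supIntegral_mul_lintegral_dilate_le μ ht (G := B i)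
    (fun x => hdecay (hD₀ i x)) (hE t ht)
  have h1 := supIntegral_mul_lintegral_dilate_le μ ht
    (G := ((t ^ (2 * M) : ℝ) : ℂ) • laplacePow M (B i))
    (D := ENNReal.ofReal (t ^ (2 * M)) * ENNReal.ofReal D₁) (fun x => by
      rw [smul_apply, smul_eq_mul, enorm_mul, mul_assoc]
      refine mul_le_mul' ?_ (hdecay (hD₁ i x))
      rw [← ofReal_norm, Complex.norm_real, Real.norm_of_nonneg (by positivity)]) (hE t ht)
  have h2 : ENNReal.ofReal (t ^ (-(2 * M : ℝ))) * ENNReal.ofReal (t ^ (2 * M)) = 1 := by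
    rw [← ENNReal.ofReal_mul (by positivity), ← Real.rpow_natCast, ← Real.rpow_add ht]
    simp
  have h3 : ENNReal.ofReal (t ^ (Module.finrank ℝ V * (1 / q - 1 / 2) - Module.finrank ℝ V / 2)) =
      ENNReal.ofReal (t ^ (Module.finrank ℝ V * (1 / q - 1 / 2))) *
        ENNReal.ofReal (t ^ (-(Module.finrank ℝ V / 2 : ℝ))) := by
    rw [← ENNReal.ofReal_mul (by positivity), ← Real.rpow_add ht, sub_eq_add_neg]
  rw [h3]
  clear h3
  generalize (E * ∫⁻ x : V, decayWeight x) ^ ((1 : ℝ) / 2) = W at *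
  generalize (⨆ x, μ (Metric.closedBall x t⁻¹)) ^ ((1 : ℝ) / 2) = S at *
  generalize ENNReal.ofReal (t ^ (-(Module.finrank ℝ V / 2 : ℝ))) = T at *
  generalize ENNReal.ofReal (t ^ (Module.finrank ℝ V * (1 / q - 1 / 2))) = U at *
  refine (mul_le_mul' (mul_le_mul' le_rfl (add_le_add h0 (mul_le_mul' le_rfl h1)))
    le_rfl).trans_eq ?_
  calc _ = K * U * (ENNReal.ofReal D₀ * W * T * S + (ENNReal.ofReal (t ^ (-(2 * M : ℝ))) *
        ENNReal.ofReal (t ^ (2 * M))) * (ENNReal.ofReal D₁ * W * T * S)) *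
        eLpNorm f (ENNReal.ofReal p) volume := by ring
    _ = _ := by rw [h2]; ring

/-- The functions `x ↦ χ (c x) * β x`, `0 ≤ c ≤ 1`, form a bounded family of Schwartz functions. -/
lemma exists_seminorm_comp_smul_mul_le {χ : V → ℂ} (hχ1 : ContDiff ℝ ∞ χ)
    (hχ2 : HasCompactSupport χ) (β : SchwartzMap V ℂ) {ι : Type*} {c : ι → ℝ}
    (hc0 : ∀ i, 0 ≤ c i) (hc1 : ∀ i, c i ≤ 1) {B : ι → SchwartzMap V ℂ}
    (hB : ∀ i x, B i x = χ (c i • x) * β x) (k m : ℕ) :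
    ∃ C, ∀ i, SchwartzMap.seminorm ℂ k m (B i) ≤ C := by
  let X : SchwartzMap V ℂ := hχ2.toSchwartzMap hχ1
  refine ⟨∑ j ∈ Finset.range (m + 1), (m.choose j : ℝ) * SchwartzMap.seminorm ℝ 0 j X *
    SchwartzMap.seminorm ℝ k (m - j) β, fun i => ?_⟩
  refine SchwartzMap.seminorm_le_bound ℂ k m _
    (Finset.sum_nonneg fun j _ => by positivity) fun x => ?_
  have e : (B i : V → ℂ) = fun x => χ (c i • x) * β x := funext (hB i)
  rw [e]
  have hs : ContDiff ℝ ∞ (fun x : V => χ (c i • x)) := hχ1.comp (contDiff_const_smul _)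
  have h1 := norm_iteratedFDeriv_mul_le hs (β.smooth ⊤) x (n := m) (by exact_mod_cast le_top)
  refine (mul_le_mul_of_nonneg_left h1 (by positivity)).trans ?_
  rw [Finset.mul_sum]
  refine Finset.sum_le_sum fun j _ => ?_
  have h2 : ‖iteratedFDeriv ℝ j (fun x : V => χ (c i • x)) x‖ ≤ SchwartzMap.seminorm ℝ 0 j X := by
    rw [iteratedFDeriv_comp_const_smul _ (hχ1.of_le (by exact_mod_cast le_top)), norm_smul, norm_pow,
      Real.norm_of_nonneg (hc0 i)]
    refine (mul_le_of_le_one_left (norm_nonneg _) (pow_le_one₀ (hc0 i) (hc1 i))).trans ?_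
    exact SchwartzMap.norm_iteratedFDeriv_le_seminorm ℝ X j _
  have h3 := SchwartzMap.le_seminorm ℝ k (m - j) β x
  calc _ = (m.choose j : ℝ) * ‖iteratedFDeriv ℝ j (fun x : V => χ (c i • x)) x‖ *
        (‖x‖ ^ k * ‖iteratedFDeriv ℝ (m - j) β x‖) := by ring
    _ ≤ _ := by gcongr

lemma HasCompactSupport.exists_pos_eq_zero {χ : V → ℂ} (hχ : HasCompactSupport χ) :
    ∃ R : ℝ, 0 < R ∧ ∀ x, χ x ≠ 0 → ‖x‖ < R := by
  obtain ⟨R, hR0, hR⟩ := hχ.isCompact.isBounded.subset_ball_lt 0 (0 : V)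
  exact ⟨R, hR0, fun x hx => by simpa using hR (subset_tsupport _ hx)⟩

lemma integrable_mul_norm_rpow [Nontrivial V] {χ : V → ℂ} (hχ1 : Continuous χ)
    (hχ2 : HasCompactSupport χ) {s : ℝ} (hs : -(Module.finrank ℝ V : ℝ) < s) :
    Integrable (fun x : V => χ x * ((‖x‖ ^ s : ℝ) : ℂ)) := by
  obtain ⟨R, hR0, hR⟩ := hχ2.exists_pos_eq_zero
  have hn : 1 ≤ Module.finrank ℝ V := Module.finrank_pos
  have h1 : IntegrableOn (fun x : V => ‖x‖ ^ s) (Metric.ball 0 R) := by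
    rw [integrableOn_fun_norm_addHaar volume (f := fun r : ℝ => r ^ s)]
    have h2 : IntegrableOn (fun y : ℝ => y ^ ((Module.finrank ℝ V - 1 : ℝ) + s)) (Set.Ioo 0 R) := by
      rw [intervalIntegral.integrableOn_Ioo_rpow_iff hR0]
      linarith
    refine h2.congr_fun (fun y hy => ?_) measurableSet_Ioo
    simp only [smul_eq_mul]
    rw [← Real.rpow_natCast, ← Real.rpow_add hy.1, Nat.cast_sub hn]
    simp
  have hsupp : Function.support (fun x : V => χ x * ((‖x‖ ^ s : ℝ) : ℂ)) ⊆ Metric.ball 0 R := by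
    intro x hx
    simpa using hR x (left_ne_zero_of_mul hx)
  rw [← integrableOn_iff_integrable_of_support_subset hsupp]
  obtain ⟨D, hD⟩ := hχ2.exists_bound_of_continuous hχ1
  exact Integrable.bdd_mul h1.ofReal hχ1.aestronglyMeasurable (.of_forall hD)

/-- Dyadic decomposition of the kernel `χ * ‖x‖ ^ s` into rescaled Schwartz functions. -/
lemma exists_dyadic_decomposition {χ : V → ℂ} (hχ1 : ContDiff ℝ ∞ χ)
    (hχ2 : HasCompactSupport χ) (s : ℝ) :
    ∃ (B : ℕ → SchwartzMap V ℂ) (ρ : ContDiffBump (0 : V)),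
      (∀ k m : ℕ, ∃ C, ∀ i, SchwartzMap.seminorm ℂ k m (B i) ≤ C) ∧
      (∀ x, χ x ≠ 0 → ρ x = 1) ∧
      ∀ j x, ((((2 : ℝ) ^ j) ^ (-s) : ℝ) : ℂ) * B j ((2 : ℝ) ^ j • x) =
        (χ x * ((‖x‖ ^ s : ℝ) : ℂ)) *
          ((ρ ((2 : ℝ) ^ j • x) - ρ ((2 : ℝ) ^ (j + 1) • x) : ℝ) : ℂ) := by
  obtain ⟨R, hR0, hR⟩ := hχ2.exists_pos_eq_zero
  let ρ : ContDiffBump (0 : V) := ⟨R, R + 1, hR0, by linarith⟩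
  let β : SchwartzMap V ℂ := (hasCompactSupport_annulusBump ρ s).toSchwartzMap
    (contDiff_annulusBump ρ s)
  have hβ : ∀ x, β x = ((‖x‖ ^ s * (ρ x - ρ ((2 : ℝ) • x)) : ℝ) : ℂ) := fun x => rfl
  have hsupp : ∀ j : ℕ, HasCompactSupport (fun x => χ (((2 : ℝ) ^ j)⁻¹ • x) * β x) := fun j =>
    (hasCompactSupport_annulusBump ρ s).mul_left
  let B : ℕ → SchwartzMap V ℂ := fun j => (hsupp j).toSchwartzMap
    ((hχ1.comp (contDiff_const_smul _)).mul (β.smooth ⊤))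
  have hB : ∀ j x, B j x = χ (((2 : ℝ) ^ j)⁻¹ • x) * β x := fun j x => rfl
  clear_value B β
  refine ⟨B, ρ, fun k m => ?_, fun x hx => ?_, fun j x => ?_⟩
  · exact exists_seminorm_comp_smul_mul_le hχ1 hχ2 β (fun i => by positivity)
      (fun i => inv_le_one_of_one_le₀ (one_le_pow₀ one_le_two)) hB k m
  · exact ρ.one_of_mem_closedBall (by simpa [ρ] using (hR x hx).le)
  · have h2 : (0 : ℝ) < 2 ^ j := by positivity
    rw [hB, hβ, smul_smul, smul_smul, inv_mul_cancel₀ h2.ne', one_smul, norm_smul,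
      Real.norm_of_nonneg h2.le, Real.mul_rpow h2.le (norm_nonneg x), ← pow_succ']
    have h3 : ((2 : ℝ) ^ j) ^ (-s) * ((2 : ℝ) ^ j) ^ s = 1 := by
      rw [← Real.rpow_add h2]; simp
    have h4 : ((((2 : ℝ) ^ j) ^ (-s) : ℝ) : ℂ) * ((((2 : ℝ) ^ j) ^ s : ℝ) : ℂ) = 1 := by
      exact_mod_cast h3
    generalize ((2 : ℝ) ^ j) ^ (-s) = y at *
    generalize ((2 : ℝ) ^ j) ^ s = z at *
    push_cast
    linear_combination (χ x * ((‖x‖ ^ s : ℝ) : ℂ) *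
      (ρ ((2 : ℝ) ^ j • x) - ρ ((2 : ℝ) ^ (j + 1) • x))) * h4

lemma integrable_fourierChar_inner_smul {m : V → ℂ} (hm : Integrable m) (x : V) :
    Integrable (fun v => Real.fourierChar ⟪v, x⟫ • m v) := by
  refine hm.norm.mono' ?_ (.of_forall fun v => by rw [Circle.norm_smul])
  have h1 : Continuous fun v : V => Real.fourierChar ⟪v, x⟫ :=
    Real.continuous_fourierChar.comp (by fun_prop)
  exact h1.aestronglyMeasurable.smul hm.aestronglyMeasurable

lemma sum_mul_fourierInv_eq {g : V → ℂ} {ρ : ContDiffBump (0 : V)} (hgρ : ∀ x, g x * ρ x = g x)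
    {G : ℕ → SchwartzMap V ℂ} {c : ℕ → ℝ} (hG : ∀ j x, (c j : ℂ) * G j x =
      g x * ((ρ ((2 : ℝ) ^ j • x) - ρ ((2 : ℝ) ^ (j + 1) • x) : ℝ) : ℂ)) (N : ℕ) (x : V) :
    ∑ j ∈ Finset.range N, (c j : ℂ) * (𝓕⁻ (G j) : SchwartzMap V ℂ) x =
      𝓕⁻ (fun v => g v * ((1 - ρ ((2 : ℝ) ^ N • v) : ℝ) : ℂ)) x := by
  simp only [SchwartzMap.fourierInv_coe, Real.fourierInv_eq]
  simp_rw [← integral_const_mul]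
  rw [← integral_finsetSum]
  · congr 1
    ext v
    have h : ∑ j ∈ Finset.range N, (c j : ℂ) * G j v =
        g v * ((1 - ρ ((2 : ℝ) ^ N • v) : ℝ) : ℂ) := by
      simp_rw [hG, ← Finset.mul_sum, ← Complex.ofReal_sum]
      rw [Finset.sum_range_sub' (fun j => ρ ((2 : ℝ) ^ j • v))]
      push_cast
      rw [mul_sub, mul_sub, pow_zero, one_smul, hgρ, mul_one]
    rw [← h, Finset.smul_sum]
    refine Finset.sum_congr rfl fun j _ => ?_
    simp only [Circle.smul_def, smul_eq_mul]
    ring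
  · intro j _
    refine Integrable.const_mul ?_ _
    exact integrable_fourierChar_inner_smul (G j).integrable x

lemma norm_mul_one_sub_bump_le (g : V → ℂ) (ρ : ContDiffBump (0 : V)) (v w : V) :
    ‖g v * ((1 - ρ w : ℝ) : ℂ)‖ ≤ ‖g v‖ := by
  rw [norm_mul, Complex.norm_real, Real.norm_of_nonneg (sub_nonneg.2 ρ.le_one)]
  exact mul_le_of_le_one_right (norm_nonneg _) (by linarith [ρ.nonneg (x := w)])

lemma norm_fourierInv_mul_one_sub_bump_le {g : V → ℂ} (hg : Integrable g)
    (ρ : ContDiffBump (0 : V)) (t : ℝ) (x : V) :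
    ‖𝓕⁻ (fun v => g v * ((1 - ρ (t • v) : ℝ) : ℂ)) x‖ ≤ ∫ v, ‖g v‖ := by
  rw [Real.fourierInv_eq]
  refine norm_integral_le_of_norm_le hg.norm (.of_forall fun v => ?_)
  rw [Circle.norm_smul]
  exact norm_mul_one_sub_bump_le g ρ v _

lemma tendsto_fourierInv_mul_one_sub_bump [Nontrivial V] {g : V → ℂ} (hg : Integrable g)
    (ρ : ContDiffBump (0 : V)) (x : V) :
    Tendsto (fun N : ℕ => 𝓕⁻ (fun v => g v * ((1 - ρ ((2 : ℝ) ^ N • v) : ℝ) : ℂ)) x) atTop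
      (nhds (𝓕⁻ g x)) := by
  simp_rw [Real.fourierInv_eq]
  refine tendsto_integral_of_dominated_convergence (fun v => ‖g v‖) (fun N => ?_) hg.norm
    (fun N => .of_forall fun v => ?_) ?_
  · have h1 : Continuous fun v : V => Real.fourierChar ⟪v, x⟫ :=
      Real.continuous_fourierChar.comp (by fun_prop)
    have h2 : Continuous fun v : V => ((1 - ρ ((2 : ℝ) ^ N • v) : ℝ) : ℂ) := by
      have := ρ.continuous
      fun_prop
    exact h1.aestronglyMeasurable.smul (hg.aestronglyMeasurable.mul h2.aestronglyMeasurable)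
  · rw [Circle.norm_smul]
    exact norm_mul_one_sub_bump_le g ρ v _
  · have h0 : ∀ᵐ v : V, v ≠ 0 := by
      simp [ae_iff]
    filter_upwards [h0] with v hv
    refine tendsto_const_nhds.congr' ?_
    have h1 : Tendsto (fun N : ℕ => (2 : ℝ) ^ N * ‖v‖) atTop atTop :=
      (tendsto_pow_atTop_atTop_of_one_lt one_lt_two).atTop_mul_const (norm_pos_iff.2 hv)
    filter_upwards [h1.eventually_ge_atTop ρ.rOut] with N hN
    rw [ρ.zero_of_le_dist]
    · simp
    · rw [dist_zero_right, norm_smul, Real.norm_of_nonneg (by positivity)]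
      exact hN

/-- The `L^p → L^q` bound for convolution with `μ̌` times the inverse Fourier transform of
`χ * ‖x‖ ^ s`, as a sum over dyadic scales. -/
lemma exists_eLpNorm_convolution_le_tsum_dyadic [Nontrivial V] (μ : Measure V)
    [IsProbabilityMeasure μ]
    {p q A : ℝ} (hp : 1 ≤ p) (hpq : p ≤ q) (hq : q ≤ 2) (hrestr : HasRestriction μ p A)
    {χ : V → ℂ} (hχ1 : ContDiff ℝ ∞ χ) (hχ2 : HasCompactSupport χ) {s : ℝ}
    (hs : -(Module.finrank ℝ V : ℝ) < s) :
    ∃ C : ℝ≥0∞, C ≠ ⊤ ∧ ∀ f : SchwartzMap V ℂ,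
      eLpNorm ((fun x => measureFourierInv μ x *
        𝓕⁻ (fun x : V => χ x * ((‖x‖ ^ s : ℝ) : ℂ)) x) ⋆[mul ℂ ℂ, volume] f)
        (ENNReal.ofReal q) volume ≤
      C * (∑' j : ℕ, ENNReal.ofReal (((2 : ℝ) ^ j) ^
          (Module.finrank ℝ V * (1 / q - 1 / 2) - Module.finrank ℝ V / 2 - s)) *
        (⨆ x, μ (Metric.closedBall x ((2 : ℝ) ^ j)⁻¹)) ^ ((1 : ℝ) / 2)) *
        eLpNorm f (ENNReal.ofReal p) volume := by
  obtain ⟨B, ρ, hB, hρ, hBρ⟩ := exists_dyadic_decomposition hχ1 hχ2 s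
  obtain ⟨C, hCt, hC⟩ := exists_eLpNorm_fourierInv_dilate_convolution_le μ hp hpq hq hrestr hB
  refine ⟨C, hCt, fun f => ?_⟩
  have hgi := integrable_mul_norm_rpow hχ1.continuous hχ2 hs
  have hgρ : ∀ x : V, (χ x * ((‖x‖ ^ s : ℝ) : ℂ)) * (ρ x : ℂ) = χ x * ((‖x‖ ^ s : ℝ) : ℂ) := by
    intro x
    by_cases hx : χ x = 0
    · simp [hx]
    · rw [hρ x hx]; simp
  obtain ⟨g, hgdef⟩ : ∃ g, g = fun x : V => χ x * ((‖x‖ ^ s : ℝ) : ℂ) := ⟨_, rfl⟩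
  have hgx : ∀ x, χ x * ((‖x‖ ^ s : ℝ) : ℂ) = g x := fun x => by rw [hgdef]
  rw [← hgdef] at hgi ⊢
  simp_rw [hgx] at hgρ hBρ
  have h2 : ∀ j : ℕ, (0 : ℝ) < 2 ^ j := fun j => by positivity
  have hsum := sum_mul_fourierInv_eq hgρ (G := fun j => SchwartzMap.dilate (h2 j) (B j))
    (c := fun j => ((2 : ℝ) ^ j) ^ (-s)) hBρ
  refine (eLpNorm_convolution_le_tsum μ (by simpa using hp.trans hpq)
    (κ := fun j x => ((((2 : ℝ) ^ j) ^ (-s) : ℝ) : ℂ) *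
      (𝓕⁻ (SchwartzMap.dilate (h2 j) (B j)) : SchwartzMap V ℂ) x)
    (fun j => continuous_const.mul (SchwartzMap.continuous _))
    (fun j => (SchwartzMap.integrable _).const_mul _) (C := ∫ v, ‖g v‖) (κ' := 𝓕⁻ g)
    (fun x => ?_) (fun N x => ?_) f (fun j => (eLpNorm_const_mul_convolution_le μ _ _ _ _).trans
      (mul_le_mul' le_rfl (hC j _ (h2 j) f)))).trans_eq ?_
  · simp_rw [hsum]
    exact tendsto_fourierInv_mul_one_sub_bump hgi ρ x
  · rw [hsum]
    exact norm_fourierInv_mul_one_sub_bump_le hgi ρ _ x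
  · rw [mul_assoc, ← ENNReal.tsum_mul_right, ← ENNReal.tsum_mul_left]
    congr 1
    ext j
    have h3 : ENNReal.ofReal (((2 : ℝ) ^ j) ^
          (Module.finrank ℝ V * (1 / q - 1 / 2) - Module.finrank ℝ V / 2 - s)) =
        ENNReal.ofReal |((2 : ℝ) ^ j) ^ (-s)| * ENNReal.ofReal (((2 : ℝ) ^ j) ^
          (Module.finrank ℝ V * (1 / q - 1 / 2) - Module.finrank ℝ V / 2)) := by
      rw [← ENNReal.ofReal_mul (abs_nonneg _), abs_of_nonneg (by positivity),
        ← Real.rpow_add (h2 j)]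
      congr 2
      ring
    rw [h3]
    ring

lemma integrable_comp_sub_prod (μ : Measure V) [IsProbabilityMeasure μ] {g : V → ℂ}
    (hgm : StronglyMeasurable g) (hg : Integrable g) :
    Integrable (fun z : V × V => g (z.1 - z.2)) (volume.prod μ) := by
  refine (integrable_prod_iff' (hgm.comp_measurable (by fun_prop)).aestronglyMeasurable).2
    ⟨.of_forall fun η => hg.comp_sub_right η, ?_⟩
  have : (fun η => ∫ ξ, ‖g (ξ - η)‖) = fun _ => ∫ ξ, ‖g ξ‖ := by
    ext η
    exact integral_sub_right_eq_self (fun ξ => ‖g ξ‖) η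
  change Integrable (fun η => ∫ ξ, ‖g (ξ - η)‖) μ
  rw [this]
  exact integrable_const _

lemma fourierInv_integral_sub (μ : Measure V) [IsProbabilityMeasure μ] {g : V → ℂ}
    (hgm : StronglyMeasurable g) (hg : Integrable g) (x : V) :
    𝓕⁻ (fun ξ => ∫ η, g (ξ - η) ∂μ) x = measureFourierInv μ x * 𝓕⁻ g x := by
  have hP : Integrable (fun z : V × V => Real.fourierChar ⟪z.1, x⟫ • g (z.1 - z.2))
      (volume.prod μ) := by
    refine (integrable_comp_sub_prod μ hgm hg).norm.mono' ?_ (.of_forall fun z => ?_)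
    · have h1 : Continuous fun z : V × V => Real.fourierChar ⟪z.1, x⟫ :=
        Real.continuous_fourierChar.comp (by fun_prop)
      exact h1.aestronglyMeasurable.smul (hgm.comp_measurable (by fun_prop)).aestronglyMeasurable
    · rw [Circle.norm_smul]
  rw [Real.fourierInv_eq, Real.fourierInv_eq, measureFourierInv]
  calc _ = ∫ ξ, ∫ η, Real.fourierChar ⟪ξ, x⟫ • g (ξ - η) ∂μ := by
        simp_rw [Circle.smul_def]
        simp_rw [integral_smul]
    _ = ∫ η, ∫ ξ, Real.fourierChar ⟪ξ, x⟫ • g (ξ - η) ∂volume ∂μ := integral_integral_swap hP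
    _ = ∫ η, (Real.fourierChar ⟪x, η⟫ : ℂ) * ∫ ξ, Real.fourierChar ⟪ξ, x⟫ • g ξ ∂volume ∂μ := by
        congr 1
        ext η
        rw [← integral_const_mul,
          ← integral_sub_right_eq_self (fun ξ => (Real.fourierChar ⟪x, η⟫ : ℂ) *
            (Real.fourierChar ⟪ξ, x⟫ • g ξ)) η]
        congr 1
        ext ξ
        simp only [Circle.smul_def, smul_eq_mul]
        rw [← mul_assoc, ← Circle.coe_mul, ← AddChar.map_add_eq_mul, inner_sub_left,
          real_inner_comm x η, add_sub_cancel]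
    _ = _ := integral_mul_const _ _

lemma fourierInv_mul_fourier_eq_convolution {m f : V → ℂ} (hm : Integrable m) (hf : Integrable f) :
    𝓕⁻ (fun ξ => m ξ * 𝓕 f ξ) = (𝓕⁻ m) ⋆[mul ℂ ℂ, volume] f := by
  ext x
  have h := VectorFourier.integral_fourierIntegral_smul_eq_flip (e := Real.fourierChar)
    (L := innerₗ V) (μ := volume) (ν := volume) Real.continuous_fourierChar
    (by exact continuous_inner) hf (integrable_fourierChar_inner_smul hm x)
  rw [flip_innerₗ] at h
  change ∫ ξ, 𝓕 f ξ • (Real.fourierChar ⟪ξ, x⟫ • m ξ) =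
    ∫ y, f y • 𝓕 (fun ξ => Real.fourierChar ⟪ξ, x⟫ • m ξ) y at h
  rw [convolution_mul_swap, Real.fourierInv_eq]
  calc _ = ∫ ξ, 𝓕 f ξ • (Real.fourierChar ⟪ξ, x⟫ • m ξ) := by
        congr 1
        ext ξ
        simp only [Circle.smul_def, smul_eq_mul]
        ring
    _ = _ := h
    _ = _ := by
        congr 1
        ext y
        rw [smul_eq_mul, mul_comm, Real.fourier_eq, Real.fourierInv_eq]
        congr 2
        ext ξ
        simp only [Circle.smul_def, smul_eq_mul]
        rw [← mul_assoc, ← Circle.coe_mul, ← AddChar.map_add_eq_mul, inner_sub_right,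
          sub_eq_neg_add]

lemma fourierInv_integral_sub_mul_fourier (μ : Measure V) [IsProbabilityMeasure μ] {g f : V → ℂ}
    (hgm : StronglyMeasurable g) (hg : Integrable g) (hf : Integrable f) :
    𝓕⁻ (fun ξ => (∫ η, g (ξ - η) ∂μ) * 𝓕 f ξ) =
      (fun x => measureFourierInv μ x * 𝓕⁻ g x) ⋆[mul ℂ ℂ, volume] f := by
  rw [fourierInv_mul_fourier_eq_convolution
    (integrable_comp_sub_prod μ hgm hg).integral_prod_left hf]
  congr 1
  exact funext (fourierInv_integral_sub μ hgm hg)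

lemma tsum_dyadic_ne_top_of_le_rpow {Φ : ℝ → ℝ≥0∞} {b D e : ℝ} (he : e < b / 2)
    (hΦ : ∀ r, 0 < r → r ≤ 1 → Φ r ≤ ENNReal.ofReal (D * r ^ b)) :
    ∑' j : ℕ, ENNReal.ofReal (((2 : ℝ) ^ j) ^ e) * Φ ((2 : ℝ) ^ j)⁻¹ ^ ((1 : ℝ) / 2) ≠ ⊤ := by
  have hhalf : (0 : ℝ) ≤ 1 / 2 := by norm_num
  have hterm : ∀ j : ℕ, ENNReal.ofReal (((2 : ℝ) ^ j) ^ e) * Φ ((2 : ℝ) ^ j)⁻¹ ^ ((1 : ℝ) / 2) ≤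
      ENNReal.ofReal D ^ ((1 : ℝ) / 2) * ENNReal.ofReal ((2 : ℝ) ^ (e - b / 2)) ^ j := by
    intro j
    have h2 : (0 : ℝ) < 2 ^ j := by positivity
    have h1 := hΦ ((2 : ℝ) ^ j)⁻¹ (by positivity) (inv_le_one_of_one_le₀ (one_le_pow₀ one_le_two))
    refine (mul_le_mul' le_rfl (ENNReal.rpow_le_rpow h1 hhalf)).trans_eq ?_
    rw [ENNReal.ofReal_mul' (by positivity), ENNReal.mul_rpow_of_nonneg _ _ hhalf,
      mul_left_comm,
      ENNReal.ofReal_rpow_of_pos (Real.rpow_pos_of_pos (inv_pos.2 h2) b), Real.inv_rpow h2.le,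
      ← Real.rpow_neg h2.le, ← Real.rpow_mul h2.le, ← ENNReal.ofReal_mul (by positivity),
      ← Real.rpow_add h2, ← ENNReal.ofReal_pow (by positivity), ← Real.rpow_natCast,
      ← Real.rpow_natCast, ← Real.rpow_mul zero_le_two, ← Real.rpow_mul zero_le_two]
    congr 3
    ring
  refine ne_top_of_le_ne_top ?_ (ENNReal.tsum_le_tsum hterm)
  rw [ENNReal.tsum_mul_left, ENNReal.tsum_geometric]
  refine ENNReal.mul_ne_top (ENNReal.rpow_ne_top_of_nonneg hhalf ENNReal.ofReal_ne_top) ?_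
  rw [ENNReal.inv_ne_top, Ne, tsub_eq_zero_iff_le, not_le, ENNReal.ofReal_lt_one]
  exact Real.rpow_lt_one_of_one_lt_of_neg one_lt_two (by linarith)

lemma tsum_dyadic_ne_top_of_integrableOn {Φ : ℝ → ℝ≥0∞} (hΦm : Monotone Φ) (hΦt : ∀ r, Φ r ≠ ⊤)
    {a : ℝ} (ha : 0 ≤ a)
    (hfin_int : IntegrableOn (fun t : ℝ => (t ^ (-a) * (Φ t).toReal) ^ ((1 : ℝ) / 2) / t)
      (Set.Ioo (0 : ℝ) 1)) :
    ∑' j : ℕ, ENNReal.ofReal (((2 : ℝ) ^ j) ^ (a / 2)) * Φ ((2 : ℝ) ^ j)⁻¹ ^ ((1 : ℝ) / 2) ≠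
      ⊤ := by
  have hhalf : (0 : ℝ) ≤ 1 / 2 := by norm_num
  have h2 : ∀ j : ℕ, (0 : ℝ) < 2 ^ j := fun j => by positivity
  obtain ⟨F, hF⟩ : ∃ F : ℝ → ℝ, F = fun t : ℝ =>
      (t ^ (-a) * (Φ t).toReal) ^ ((1 : ℝ) / 2) / t := ⟨_, rfl⟩
  rw [← hF] at hfin_int
  let u : ℕ → ℝ := fun j => ((2 : ℝ) ^ j)⁻¹
  have hu : Antitone u := fun i j hij =>
    inv_anti₀ (h2 i) (pow_le_pow_right₀ one_le_two hij)
  have hterm : ∀ j : ℕ, ENNReal.ofReal (((2 : ℝ) ^ (j + 1)) ^ (a / 2)) *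
      Φ ((2 : ℝ) ^ (j + 1))⁻¹ ^ ((1 : ℝ) / 2) ≤
      ENNReal.ofReal (2 * 2 ^ (a / 2)) * ∫⁻ t in Set.Ioo (u (j + 1)) (u j), ‖F t‖ₑ := by
    intro j
    obtain ⟨c, hc⟩ : ∃ c, c = (Φ (u (j + 1))).toReal := ⟨_, rfl⟩
    have hc0 : 0 ≤ c := hc ▸ ENNReal.toReal_nonneg
    have hle : ∀ t ∈ Set.Ioo (u (j + 1)) (u j),
        ENNReal.ofReal (((2 : ℝ) ^ j) ^ (a / 2) * c ^ ((1 : ℝ) / 2) * 2 ^ j) ≤ ‖F t‖ₑ := by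
      intro t ht
      have ht0 : 0 < t := lt_trans (inv_pos.2 (h2 _)) ht.1
      have hct : c ≤ (Φ t).toReal := by
        rw [hc]
        exact ENNReal.toReal_mono (hΦt t) (hΦm ht.1.le)
      have hti : (2 : ℝ) ^ j ≤ t⁻¹ := by
        rw [le_inv_comm₀ (h2 j) ht0]
        exact ht.2.le
      have hF0 : 0 ≤ F t := by rw [hF]; positivity
      rw [← ofReal_norm, Real.norm_of_nonneg hF0, hF]
      apply ENNReal.ofReal_le_ofReal
      simp only
      rw [div_eq_mul_inv _ t, Real.mul_rpow (by positivity) ENNReal.toReal_nonneg,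
        Real.rpow_neg_eq_inv_rpow, ← Real.rpow_mul (by positivity), mul_one_div]
      gcongr
    have hvol : volume (Set.Ioo (u (j + 1)) (u j)) = ENNReal.ofReal (((2 : ℝ) ^ (j + 1))⁻¹) := by
      rw [Real.volume_Ioo]
      congr 1
      simp only [u]
      rw [pow_succ]
      field_simp
      norm_num
    have hI := setLIntegral_mono' (μ := volume) measurableSet_Ioo hle
    rw [setLIntegral_const, hvol] at hI
    refine le_trans (le_of_eq ?_) (mul_le_mul' le_rfl hI)
    have h3 : Φ ((2 : ℝ) ^ (j + 1))⁻¹ ^ ((1 : ℝ) / 2) = ENNReal.ofReal (c ^ ((1 : ℝ) / 2)) := by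
      rw [← ENNReal.ofReal_rpow_of_nonneg hc0 hhalf, hc, ENNReal.ofReal_toReal (hΦt _)]
    rw [h3, ← ENNReal.ofReal_mul (by positivity), ← ENNReal.ofReal_mul (by positivity),
      ← ENNReal.ofReal_mul (by positivity), pow_succ, Real.mul_rpow (h2 j).le zero_le_two]
    congr 1
    have := h2 j
    field_simp
  have hsub : ⋃ j, Set.Ioo (u (j + 1)) (u j) ⊆ Set.Ioo 0 1 := by
    refine Set.iUnion_subset fun j => Set.Ioo_subset_Ioo (inv_pos.2 (h2 _)).le ?_
    exact inv_le_one_of_one_le₀ (one_le_pow₀ one_le_two)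
  rw [tsum_eq_zero_add' ENNReal.summable]
  refine ENNReal.add_ne_top.2 ⟨ENNReal.mul_ne_top ENNReal.ofReal_ne_top
    (ENNReal.rpow_ne_top_of_nonneg hhalf (hΦt _)), ?_⟩
  refine ne_top_of_le_ne_top ?_ (ENNReal.tsum_le_tsum hterm)
  rw [ENNReal.tsum_mul_left, ← lintegral_iUnion (fun j => measurableSet_Ioo)
    (by exact hu.pairwise_disjoint_on_Ioo_succ)]
  refine ENNReal.mul_ne_top ENNReal.ofReal_ne_top (ne_top_of_le_ne_top ?_
    (lintegral_mono_set hsub))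
  exact hfin_int.2.ne

/-- The multiplier `(χ ‖·‖ ^ s) * μ` is bounded from `L^p` to `L^q` as soon as the dyadic sum
converges. -/
lemma exists_eLpNorm_fourierInv_multiplier_le [Nontrivial V] (μ : Measure V)
    [IsProbabilityMeasure μ]
    {p q A : ℝ} (hp : 1 ≤ p) (hpq : p ≤ q) (hq : q ≤ 2) (hrestr : HasRestriction μ p A)
    {χ : V → ℂ} (hχ1 : ContDiff ℝ ∞ χ) (hχ2 : HasCompactSupport χ) {s : ℝ}
    (hs : -(Module.finrank ℝ V : ℝ) < s)
    (hsum : ∑' j : ℕ, ENNReal.ofReal (((2 : ℝ) ^ j) ^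
          (Module.finrank ℝ V * (1 / q - 1 / 2) - Module.finrank ℝ V / 2 - s)) *
        (⨆ x, μ (Metric.closedBall x ((2 : ℝ) ^ j)⁻¹)) ^ ((1 : ℝ) / 2) ≠ ⊤) :
    ∃ C : ℝ, ∀ f : SchwartzMap V ℂ,
      eLpNorm (𝓕⁻ (fun ξ => (∫ η, χ (ξ - η) * ((‖ξ - η‖ ^ s : ℝ) : ℂ) ∂μ) * 𝓕 (⇑f) ξ))
        (ENNReal.ofReal q) volume ≤
      ENNReal.ofReal C * eLpNorm f (ENNReal.ofReal p) volume := by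
  obtain ⟨C, hCt, hC⟩ := exists_eLpNorm_convolution_le_tsum_dyadic μ hp hpq hq hrestr hχ1 hχ2 hs
  generalize (∑' j : ℕ, ENNReal.ofReal (((2 : ℝ) ^ j) ^
          (Module.finrank ℝ V * (1 / q - 1 / 2) - Module.finrank ℝ V / 2 - s)) *
        (⨆ x, μ (Metric.closedBall x ((2 : ℝ) ^ j)⁻¹)) ^ ((1 : ℝ) / 2)) = S at *
  refine ⟨(C * S).toReal, fun f => ?_⟩
  rw [ENNReal.ofReal_toReal (ENNReal.mul_ne_top hCt hsum)]
  have hgm : StronglyMeasurable fun x : V => χ x * ((‖x‖ ^ s : ℝ) : ℂ) := by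
    have := hχ1.continuous.measurable
    exact Measurable.stronglyMeasurable (by fun_prop)
  have h := fourierInv_integral_sub_mul_fourier μ hgm
    (integrable_mul_norm_rpow hχ1.continuous hχ2 hs) (f.integrable (μ := volume))
  rw [h]
  exact hC f

end RestrictionMultipliers

/-- Bochner–Riesz type multipliers associated with a measure satisfying an `L^p → L²(μ)`
restriction inequality: the multiplier `m_λ(ξ) = ∫ χ(ξ−η)|ξ−η|^{λ−α} dμ(η)` is bounded from
`L^p` to `L^q` for `λ > d(1/q−1/2)−(d−α)/2`, and also at the endpoint under a Dini-type
condition on `ϖ`. -/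
theorem bochner_riesz_multiplier (d : ℕ) (hd : 1 ≤ d) (α : ℝ) (hα0 : 0 < α) (hαd : α < d)
    (μ : Measure (EuclideanSpace ℝ (Fin d))) [IsProbabilityMeasure μ]
    (hups : ∀ ε : ℝ, 0 < ε → ∃ Cε : ℝ, ∀ r : ℝ, 0 < r → r ≤ 1 →
      (⨆ x, μ (Metric.closedBall x r)) ≤ ENNReal.ofReal (Cε * r ^ (α - ε)))
    (p q : ℝ) (hp : 1 ≤ p) (hpq : p ≤ q) (hq : q ≤ 2)
    (A : ℝ)
    (hrestr : ∀ f : SchwartzMap (EuclideanSpace ℝ (Fin d)) ℂ,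
      (∫ ξ, ‖𝓕 (⇑f) ξ‖ ^ 2 ∂μ) ^ ((1:ℝ)/2) ≤
        A * (eLpNorm (⇑f) (ENNReal.ofReal p) volume).toReal)
    (χ : EuclideanSpace ℝ (Fin d) → ℂ) (hχ1 : ContDiff ℝ (⊤ : ℕ∞) χ) (hχ2 : HasCompactSupport χ)
    (lam : ℝ) (hlam : 0 < lam) :
    (d * (1/q - 1/2) - ((d:ℝ) - α)/2 < lam →
      ∃ C : ℝ, ∀ f : SchwartzMap (EuclideanSpace ℝ (Fin d)) ℂ,
        eLpNorm (𝓕⁻ (fun ξ =>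
            (∫ η, χ (ξ - η) * ((‖ξ - η‖ ^ (lam - α) : ℝ) : ℂ) ∂μ) * 𝓕 (⇑f) ξ))
            (ENNReal.ofReal q) volume ≤
          ENNReal.ofReal C * eLpNorm (⇑f) (ENNReal.ofReal p) volume) ∧
    (IntegrableOn
        (fun t : ℝ => (t ^ (-α) * (⨆ x, μ (Metric.closedBall x t)).toReal) ^ ((1:ℝ)/2) / t)
        (Set.Ioo (0:ℝ) 1) →
      lam = d * (1/q - 1/2) - ((d:ℝ) - α)/2 →
      ∃ C : ℝ, ∀ f : SchwartzMap (EuclideanSpace ℝ (Fin d)) ℂ,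
        eLpNorm (𝓕⁻ (fun ξ =>
            (∫ η, χ (ξ - η) * ((‖ξ - η‖ ^ (lam - α) : ℝ) : ℂ) ∂μ) * 𝓕 (⇑f) ξ))
            (ENNReal.ofReal q) volume ≤
          ENNReal.ofReal C * eLpNorm (⇑f) (ENNReal.ofReal p) volume) := by
  have : NeZero d := ⟨by omega⟩
  have hfr : (Module.finrank ℝ (EuclideanSpace ℝ (Fin d)) : ℝ) = d := by simp
  have hs : -(Module.finrank ℝ (EuclideanSpace ℝ (Fin d)) : ℝ) < lam - α := by
    rw [hfr]; linarith
  obtain ⟨Φ, hΦ⟩ : ∃ Φ : ℝ → ℝ≥0∞, ∀ r, (⨆ x, μ (Metric.closedBall x r)) = Φ r :=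
    ⟨_, fun _ => rfl⟩
  have hΦm : Monotone Φ := fun r r' h => by
    rw [← hΦ, ← hΦ]
    exact iSup_mono fun x => measure_mono (Metric.closedBall_subset_closedBall h)
  have hΦt : ∀ r, Φ r ≠ ⊤ := fun r => by
    rw [← hΦ]
    exact ne_top_of_le_ne_top ENNReal.one_ne_top (iSup_le fun x => prob_le_one)
  refine ⟨fun hcrit => ?_, fun hfin_int hcrit => ?_⟩
  · obtain ⟨D, hD⟩ := hups (lam - (d * (1/q - 1/2) - ((d:ℝ) - α)/2)) (by linarith)
    refine exists_eLpNorm_fourierInv_multiplier_le μ hp hpq hq hrestr hχ1 hχ2 hs ?_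
    simp_rw [hΦ] at hD ⊢
    refine tsum_dyadic_ne_top_of_le_rpow ?_ hD
    rw [hfr]
    linarith
  · refine exists_eLpNorm_fourierInv_multiplier_le μ hp hpq hq hrestr hχ1 hχ2 hs ?_
    simp_rw [hΦ] at hfin_int ⊢
    have e : (Module.finrank ℝ (EuclideanSpace ℝ (Fin d)) : ℝ) * (1 / q - 1 / 2) -
        Module.finrank ℝ (EuclideanSpace ℝ (Fin d)) / 2 - (lam - α) = α / 2 := by
      rw [hfr]
      linarith
    rw [e]
    exact tsum_dyadic_ne_top_of_integrableOn hΦm hΦt hα0.le hfin_int
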